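/- arXiv:2303.09265 — 3 statements merged into one kernel-verified Lean document; each statement's English description precedes it below -/
import Mathlib

section
/- Let p be an odd prime, q a power of p, and let ℓ : F_{q²} → F_{q²} be an F_p-linear map. Then the function f(x) = x^{q+1} + ℓ(x²) is a planar function on F_{q²} if and only if for every u ∈ F_{q²}* with ℓ(u) ∈ F_q, the element ℓ(u)² − N(u) is a nonzero square in F_q. -/
/-- In a finite field with `a * b` units, every unit killed by `a` is a `b`-th power. -/
theorem FiniteField.exists_pow_eq_of_pow_eq_one {F : Type*} [Field F] [Fintype F] {a b : ℕ}
    (hab : a * b = Fintype.card F - 1) {d : F} (hd : d ≠ 0) (h : d ^ a = 1) :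
    ∃ c : F, c ≠ 0 ∧ c ^ b = d := by
  have hpos : 0 < a * b := by
    have := Fintype.one_lt_card (α := F)
    omega
  obtain ⟨g, hg⟩ := IsCyclic.exists_generator (α := Fˣ)
  obtain ⟨k, hk⟩ := (mem_powers_iff_mem_zpowers (x := g)).2 (hg (Units.mk0 d hd))
  have hk' : g ^ k = Units.mk0 d hd := hk
  have hord : orderOf g = a * b := by
    rw [orderOf_eq_card_of_forall_mem_zpowers hg, Nat.card_units, Nat.card_eq_fintype_card, hab]
  have hone : g ^ (k * a) = 1 := by
    rw [pow_mul, hk']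
    ext
    simpa using h
  have hdvd : b ∣ k := by
    have h' := orderOf_dvd_of_pow_eq_one hone
    rw [hord, mul_comm a b] at h'
    exact Nat.dvd_of_mul_dvd_mul_right (Nat.pos_of_mul_pos_right hpos) h'
  obtain ⟨j, rfl⟩ := hdvd
  refine ⟨(g ^ j : Fˣ), Units.ne_zero _, ?_⟩
  have := congrArg Units.val hk'
  rw [mul_comm, pow_mul] at this
  simpa using this

/-- A finite field of cardinality a power of the prime `p` has characteristic `p`. -/
theorem FiniteField.charP_of_card_eq_prime_pow {F : Type*} [Field F] [Fintype F] {p n : ℕ}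
    (hp : p.Prime) (hF : Fintype.card F = p ^ n) : CharP F p := by
  obtain ⟨r, hr⟩ := CharP.exists F
  obtain ⟨k, hrp, hk⟩ := FiniteField.card F r
  have hdvd : r ∣ p ^ n := by
    rw [← hF, hk]
    exact dvd_pow_self r k.ne_zero
  rwa [← (Nat.prime_dvd_prime_iff_eq hrp hp).1 (hrp.dvd_of_dvd_pow hdvd)]

/-- `x ↦ x ^ (q + 1) + ℓ (x ^ 2)` is planar iff its polarization has no nontrivial zeros. -/
theorem planar_iff_polarization_ne_zero {F : Type*} [Field F] [Finite F] {q : ℕ}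
    (hadd : ∀ x y : F, (x + y) ^ q = x ^ q + y ^ q)
    {ℓ : F → F} (hℓ : ∀ x y, ℓ (x + y) = ℓ x + ℓ y)
    {f : F → F} (hf : ∀ x, f x = x ^ (q + 1) + ℓ (x ^ 2)) :
    (∀ c : F, c ≠ 0 → Function.Bijective (fun x => f (x + c) - f x)) ↔
      ∀ c x : F, c ≠ 0 → x ≠ 0 → x * c ^ q + x ^ q * c + 2 * ℓ (x * c) ≠ 0 := by
  have hpol : ∀ x c, f (x + c) - f x = x * c ^ q + x ^ q * c + 2 * ℓ (x * c) + f c := by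
    intro x c
    have hsq : (x + c) ^ 2 = x ^ 2 + (x * c + x * c) + c ^ 2 := by ring
    rw [hf, hf, hf, hsq, hℓ, hℓ, hℓ, pow_succ (x + c), hadd]
    ring
  have hpol_add : ∀ x y c : F, (x + y) * c ^ q + (x + y) ^ q * c + 2 * ℓ ((x + y) * c) =
      (x * c ^ q + x ^ q * c + 2 * ℓ (x * c)) + (y * c ^ q + y ^ q * c + 2 * ℓ (y * c)) := by
    intro x y c
    rw [hadd, add_mul x y c, hℓ]
    ring
  refine forall_congr' fun c => ⟨fun h x hc hx h0 => hx ?_, fun h hc => ?_⟩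
  · apply (h hc).injective
    have hx0 := hpol_add x 0 c
    rw [add_zero] at hx0
    simp only [hpol]
    linear_combination h0 + hx0
  · refine Finite.injective_iff_bijective.1 fun x y hxy => ?_
    by_contra hne
    apply h (x - y) hc (sub_ne_zero.2 hne)
    have hsub := hpol_add (x - y) y c
    rw [sub_add_cancel] at hsub
    simp only [hpol] at hxy
    linear_combination hxy - hsub


/-- `f(x) = x^{q+1} + ℓ(x²)` is planar on `F_{q²}` iff for every
nonzero `u` with `ℓ(u) ∈ F_q`, the element `ℓ(u)² − N(u)` is a nonzero square in `F_q`. -/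
theorem planar_iff_nonzero_square
    (p m : ℕ) (hp : p.Prime) (hodd : Odd p) (hm : 0 < m)
    (q : ℕ) (hq : q = p ^ m)
    (F : Type*) [Field F] [Fintype F] (hF : Fintype.card F = q ^ 2)
    (ℓ : F → F) (hℓ : ∀ x y, ℓ (x + y) = ℓ x + ℓ y)
    (f : F → F) (hf : ∀ x, f x = x ^ (q + 1) + ℓ (x ^ 2)) :
    (∀ c : F, c ≠ 0 → Function.Bijective (fun x => f (x + c) - f x)) ↔
      (∀ u : F, u ≠ 0 → (ℓ u) ^ q = ℓ u →
        ∃ b : F, b ≠ 0 ∧ b ^ q = b ∧ b ^ 2 = (ℓ u) ^ 2 - u ^ (q + 1)) := by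
  have hF' : Fintype.card F = p ^ (m * 2) := by rw [hF, hq, pow_mul]
  have : Fact p.Prime := ⟨hp⟩
  have := FiniteField.charP_of_card_eq_prime_pow hp hF'
  have hadd : ∀ x y : F, (x + y) ^ q = x ^ q + y ^ q := fun x y => by
    rw [hq, add_pow_char_pow]
  have hsub : ∀ x y : F, (x - y) ^ q = x ^ q - y ^ q := fun x y => by
    rw [hq, sub_pow_char_pow]
  have hqodd : Odd q := hq ▸ hodd.pow
  have hinv : ∀ x : F, (x ^ q) ^ q = x := fun x => by
    rw [← pow_mul, ← sq, ← hF, FiniteField.pow_card]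
  have h2 : (2 : F) ≠ 0 := Ring.two_ne_zero (by
    rw [ringChar.eq F p]
    rintro rfl
    exact absurd hodd (by decide))
  have h2q : (2 : F) ^ q = 2 := by
    rw [← one_add_one_eq_two, hadd, one_pow]
  have hcard : (q - 1) * (q + 1) = Fintype.card F - 1 := by
    rw [hF, mul_comm, ← Nat.sq_sub_sq, one_pow]
  have hqpos : 0 < q := hqodd.pos
  rw [planar_iff_polarization_ne_zero hadd hℓ hf]
  constructor
  · intro h u hu hℓu
    obtain ⟨b, hb⟩ : ∃ b : F, b ^ 2 = ℓ u ^ 2 - u ^ (q + 1) := by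
      set d := ℓ u ^ 2 - u ^ (q + 1) with hd
      rcases eq_or_ne d 0 with h0 | h0
      · exact ⟨0, by rw [h0]; ring⟩
      have hdq : d ^ q = d := by
        rw [hd, hsub, pow_right_comm, hℓu, pow_succ u, mul_pow, hinv]
        ring
      have hd1 : d ^ (q - 1) = 1 := by
        apply mul_right_cancel₀ h0
        rw [← pow_succ, Nat.sub_add_cancel hqpos, hdq, one_mul]
      obtain ⟨c, -, hc⟩ := FiniteField.exists_pow_eq_of_pow_eq_one hcard h0 hd1
      obtain ⟨k, hk⟩ := hqodd.add_one
      exact ⟨c ^ k, by rw [← pow_mul, mul_two, ← hk, hc]⟩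
    by_cases hbq : b ≠ 0 ∧ b ^ q = b
    · exact ⟨b, hbq.1, hbq.2, hb⟩
    exfalso
    have hbneg : b ^ q = -b := by
      rcases eq_or_ne b 0 with h0 | h0
      · rw [h0, zero_pow hqpos.ne', neg_zero]
      refine (sq_eq_sq_iff_eq_or_eq_neg.1 ?_).resolve_left fun h' => hbq ⟨h0, h'⟩
      rw [pow_right_comm, hb, hsub, pow_right_comm, hℓu, pow_succ u, mul_pow, hinv]
      ring
    have hz : (b - ℓ u) ^ q = -b - ℓ u := by rw [hsub, hbneg, hℓu]
    have hzN : (b - ℓ u) ^ (q + 1) = u ^ (q + 1) := by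
      rw [pow_succ, hz]
      linear_combination -hb
    have hw1 : ((b - ℓ u) / u) ^ (q + 1) = 1 := by
      rw [div_pow, hzN, div_self (pow_ne_zero _ hu)]
    have hw0 : (b - ℓ u) / u ≠ 0 := fun h0 => by
      rw [h0, zero_pow (Nat.succ_ne_zero q)] at hw1
      exact zero_ne_one hw1
    obtain ⟨c, hc, hcw⟩ := FiniteField.exists_pow_eq_of_pow_eq_one
      ((mul_comm _ _).trans hcard) hw0 hw1
    have hcq : c ^ q = (b - ℓ u) / u * c := by
      rw [← hcw, ← pow_succ, Nat.sub_add_cancel hqpos]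
    have hxc : u / c * c = u := div_mul_cancel₀ u hc
    have hz1 : u / c * c ^ q = b - ℓ u := by
      rw [hcq]
      field_simp
    have hz2 : (u / c) ^ q * c = -b - ℓ u := by
      rw [← hz, ← hz1, mul_pow, hinv]
    apply h c (u / c) hc (div_ne_zero hu hc)
    rw [hz1, hz2, hxc]
    ring
  · intro h c x hc hx h0
    have hconj : (x * c ^ q) ^ q = x ^ q * c := by rw [mul_pow, hinv]
    have hconj' : (x ^ q * c) ^ q = x * c ^ q := by rw [mul_pow, hinv]
    have hℓu : ℓ (x * c) ^ q = ℓ (x * c) := by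
      have h0q := congrArg (· ^ q) h0
      simp only [hadd, hconj, hconj', zero_pow hqpos.ne'] at h0q
      rw [mul_pow, h2q] at h0q
      apply mul_left_cancel₀ h2
      linear_combination h0q - h0
    obtain ⟨b, hb0, hbq, hb⟩ := h (x * c) (mul_ne_zero hx hc) hℓu
    have hsq : (2 * b) ^ 2 = (x * c ^ q - x ^ q * c) ^ 2 := by
      rw [mul_pow, hb, pow_succ (x * c), mul_pow x c q]
      linear_combination (2 * ℓ (x * c) - x * c ^ q - x ^ q * c) * h0
    have hbq' : (2 * b) ^ q = 2 * b := by rw [mul_pow, h2q, hbq]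
    have hneg : 2 * b = -(2 * b) := by
      rcases sq_eq_sq_iff_eq_or_eq_neg.1 hsq with h' | h'
      · conv_lhs => rw [← hbq', h', hsub, hconj, hconj']
        rw [h']
        ring
      · conv_lhs => rw [← hbq', h', hqodd.neg_pow, hsub, hconj, hconj']
        rw [h']
        ring
    have h4 : 2 * (2 * b) = 0 := by linear_combination hneg
    exact mul_ne_zero h2 (mul_ne_zero h2 hb0) h4
end

section
/- Let p be an odd prime, q = p^m, a ∈ F_{q³}*, and let ℓ(x) = Σ_{i=0}^{m−1} Σ_{j=0}^{2} b_{ij}·x^{p^i·q^j} with coefficients b_{ij} ∈ F_{q³}. Then Tr(a·x^{q+1}) + ℓ(x²) is a planar function on F_{q³} if and only if ℓ induces a bijection of F_{q³} and, for each i ∈ {0, …, m−1}, Σ_{j=0}^{2} b_{ij}·a^{2·p^i·q^{j+1}} equals 0 if i ≠ 0 and equals N(a) if i = 0. -/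
section FrobeniusOfCubicExtension

open Polynomial Finset

variable {F : Type*} [Field F] [Fintype F] {q : ℕ} {σ : F →+* F}

theorem frobenius_iterate_three (hF : Fintype.card F = q ^ 3) (hσ : ∀ x, σ x = x ^ q) (x : F) :
    σ (σ (σ x)) = x := by
  rw [hσ, hσ, hσ, ← pow_mul, ← pow_mul, ← pow_three, ← hF, FiniteField.pow_card]

theorem card_filter_pow_eq_le [DecidableEq F] {n : ℕ} (hn : 0 < n) (y : F) :
    #{x : F | x ^ n = y} ≤ n := by
  refine le_trans (Finset.card_le_card fun x hx => ?_)
    ((Multiset.toFinset_card_le _).trans (card_nthRoots n y))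
  simpa [mem_nthRoots hn] using hx

theorem le_card_image_pow [DecidableEq F] (hF : Fintype.card F = q ^ 3) {n k : ℕ} (hn : 0 < n)
    (hk : n * k = q ^ 3 - 1) :
    k ≤ #(({x : F | x ≠ 0} : Finset F).image (· ^ n)) := by
  have h := Finset.card_le_mul_card_image (s := ({x : F | x ≠ 0} : Finset F)) (f := (· ^ n)) n
    fun y _ => (Finset.card_le_card (Finset.filter_subset_filter _ (Finset.subset_univ _))).trans
      (card_filter_pow_eq_le hn y)
  have hc : #({x : F | x ≠ 0} : Finset F) = q ^ 3 - 1 := by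
    rw [Finset.filter_ne', Finset.card_erase_of_mem (Finset.mem_univ _), Finset.card_univ, hF]
  rw [hc, ← hk] at h
  exact Nat.le_of_mul_le_mul_left h hn

theorem card_filter_pow_eq_self_le [DecidableEq F] (hq : 1 < q) : #{x : F | x ^ q = x} ≤ q := by
  have h0 : (X ^ q - X : F[X]) ≠ 0 := FiniteField.X_pow_card_sub_X_ne_zero F hq
  refine le_trans (Finset.card_le_card fun x hx => ?_) ((Multiset.toFinset_card_le _).trans
    ((card_roots' _).trans (FiniteField.X_pow_card_sub_X_natDegree_eq F hq).le))
  simpa [h0, sub_eq_zero] using hx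

theorem le_card_filter_pow_eq_self [DecidableEq F] (hF : Fintype.card F = q ^ 3) (hq : 1 < q) :
    q ≤ #{x : F | x ^ q = x} := by
  have hmul : (1 + q + q ^ 2) * (q - 1) = q ^ 3 - 1 := by
    obtain ⟨n, rfl⟩ := Nat.exists_eq_add_of_lt hq
    rw [show 1 + n + 1 - 1 = n + 1 by omega]
    exact (Nat.sub_eq_of_eq_add (by ring)).symm
  have h1 := le_card_image_pow hF (by positivity) hmul
  have h2 : insert 0 (({x : F | x ≠ 0} : Finset F).image (· ^ (1 + q + q ^ 2))) ⊆
      ({x : F | x ^ q = x} : Finset F) := by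
    intro y hy
    rw [Finset.mem_insert, Finset.mem_image] at hy
    rcases hy with rfl | ⟨x, -, rfl⟩
    · simp; omega
    · have hx : x ^ q ^ 3 = x := by rw [← hF, FiniteField.pow_card]
      simp only [Finset.mem_filter, Finset.mem_univ, true_and]
      calc (x ^ (1 + q + q ^ 2)) ^ q = x ^ (q + q ^ 2) * x ^ q ^ 3 := by ring
        _ = x ^ (1 + q + q ^ 2) := by rw [hx]; ring
  have h3 := Finset.card_le_card h2
  rw [Finset.card_insert_of_notMem (by simp)] at h3
  omega

theorem natCard_fixedField (hF : Fintype.card F = q ^ 3) (hσ : ∀ x, σ x = x ^ q) (hq : 1 < q) :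
    Nat.card (σ.eqLocusField (RingHom.id F)) = q := by
  classical
  have h1 : Nat.card (σ.eqLocusField (RingHom.id F)) = #{x : F | x ^ q = x} := by
    rw [← Fintype.card_subtype, ← Nat.card_eq_fintype_card]
    exact Nat.card_congr (Equiv.subtypeEquivRight fun x => by
      rw [RingHom.mem_eqLocusField, hσ, RingHom.id_apply])
  rw [h1]
  exact le_antisymm (card_filter_pow_eq_self_le hq) (le_card_filter_pow_eq_self hF hq)

theorem exists_root_cubic (hF : Fintype.card F = q ^ 3) (hσ : ∀ x, σ x = x ^ q) (hq : 1 < q)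
    {a b c d : F} (ha0 : a ≠ 0) (ha : σ a = a) (hb : σ b = b) (hc : σ c = c) (hd : σ d = d)
    (hroot : ∀ x, σ x = x → a * x ^ 3 + b * x ^ 2 + c * x + d ≠ 0) :
    ∃ x, a * x ^ 3 + b * x ^ 2 + c * x + d = 0 := by
  set k := σ.eqLocusField (RingHom.id F)
  set P : k[X] := C ⟨a, ha⟩ * X ^ 3 + C ⟨b, hb⟩ * X ^ 2 + C ⟨c, hc⟩ * X + C ⟨d, hd⟩ with hP
  have ha0' : (⟨a, ha⟩ : k) ≠ 0 := fun h => ha0 (congrArg Subtype.val h)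
  have hdeg : P.natDegree = 3 := natDegree_cubic ha0'
  have hP0 : P ≠ 0 := by rintro h; simp [h] at hdeg
  have hirr : Irreducible P := by
    rw [irreducible_iff_roots_eq_zero_of_degree_le_three (by omega) (by omega)]
    refine Multiset.eq_zero_of_forall_notMem fun x hx => hroot x x.2 ?_
    have := congrArg Subtype.val (mem_roots'.1 hx).2
    simpa [hP] using this
  have hdvd := (hirr.natDegree_dvd_iff_dvd_X_pow_card_pow_sub_X (n := 3)).1
    (by rw [hdeg])
  rw [natCard_fixedField hF hσ hq, ← hF] at hdvd
  have hsplit : (X ^ Fintype.card F - X : F[X]).Splits := by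
    rw [splits_iff_card_roots, FiniteField.roots_X_pow_card_sub_X,
      FiniteField.X_pow_card_sub_X_natDegree_eq F Fintype.one_lt_card, ← Finset.card_def,
      Finset.card_univ]
  have hmap := Polynomial.map_dvd k.subtype hdvd
  rw [Polynomial.map_sub, Polynomial.map_pow, map_X] at hmap
  obtain ⟨x, hx⟩ := (hsplit.of_dvd (FiniteField.X_pow_card_sub_X_ne_zero F
    Fintype.one_lt_card) hmap).exists_eval_eq_zero (by
      rw [degree_map, degree_eq_natDegree hP0, hdeg]; norm_num)
  exact ⟨x, by simpa [hP] using hx⟩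

theorem exists_independent_of_trace_eq_zero (hF : Fintype.card F = q ^ 3)
    (hσ : ∀ x, σ x = x ^ q) (hq : 1 < q) {e : F} (he : e ≠ 0) :
    ∃ c d : F, e * c + σ e * σ c + σ (σ e) * σ (σ c) = 0 ∧
      e * d + σ e * σ d + σ (σ e) * σ (σ d) = 0 ∧ c * σ d - σ c * d ≠ 0 := by
  classical
  have hs3 := frobenius_iterate_three hF hσ
  set T : Finset F := {x | x + σ x + σ (σ x) = 0} with hT
  have hcard : q ^ 2 ≤ #T := by
    have h := Finset.card_le_mul_card_image_of_maps_to (s := (Finset.univ : Finset F)) (t := T)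
      (f := fun x => σ x - x) (fun x _ => by simp [hT, hs3]) q fun y _ => by
        rcases Finset.eq_empty_or_nonempty
          (({x : F | σ x - x = y} : Finset F)) with h0 | ⟨x₀, hx₀⟩
        · simp [h0]
        · refine (Finset.card_le_card_of_injOn (fun x => x - x₀) (fun x hx => ?_)
            (fun x _ z _ h => sub_left_injective h)).trans (card_filter_pow_eq_self_le (F := F) hq)
          simp only [Finset.coe_filter, Finset.mem_univ, true_and, Set.mem_ofPred_eq,
            Finset.mem_filter] at hx hx₀ ⊢
          rw [← hσ, map_sub]
          linear_combination hx - hx₀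
    rw [Finset.card_univ, hF, pow_succ' q 2] at h
    exact Nat.le_of_mul_le_mul_left h (by omega)
  obtain ⟨x, hx, hx0⟩ := Finset.exists_mem_notMem_of_card_lt_card (s := {0}) (t := T) (by
    rw [Finset.card_singleton]; nlinarith)
  rw [Finset.mem_singleton] at hx0
  obtain ⟨y, hy, hy0⟩ := Finset.exists_mem_notMem_of_card_lt_card
    (s := ({t : F | t ^ q = t} : Finset F).image (x * ·)) (t := T) (by
    have := Finset.card_image_le (s := ({t : F | t ^ q = t} : Finset F)) (f := (x * ·))
    have := card_filter_pow_eq_self_le (F := F) hq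
    nlinarith)
  simp only [hT, Finset.mem_filter, Finset.mem_univ, true_and] at hx hy
  have hse : σ e ≠ 0 := (map_ne_zero σ).2 he
  have hsse : σ (σ e) ≠ 0 := (map_ne_zero σ).2 hse
  have hsx : σ x ≠ 0 := (map_ne_zero σ).2 hx0
  refine ⟨x / e, y / e, ?_, ?_, fun h => hy0 ?_⟩
  · simp only [map_div₀]; field_simp; exact hx
  · simp only [map_div₀]; field_simp; exact hy
  · rw [Finset.mem_image]
    refine ⟨y / x, ?_, by field_simp⟩
    simp only [map_div₀] at h
    field_simp at h
    simp only [Finset.mem_filter, Finset.mem_univ, true_and]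
    rw [← hσ, map_div₀, div_eq_div_iff hsx hx0]
    linear_combination h

end FrobeniusOfCubicExtension

section CollinearTriples

open Finset

variable {F : Type*} [Field F]

theorem cubic_coeffs_of_three_roots {a b c d x y z : F} (hxy : x ≠ y) (hxz : x ≠ z) (hyz : y ≠ z)
    (hx : a * x ^ 3 + b * x ^ 2 + c * x + d = 0) (hy : a * y ^ 3 + b * y ^ 2 + c * y + d = 0)
    (hz : a * z ^ 3 + b * z ^ 2 + c * z + d = 0) :
    b = -a * (x + y + z) ∧ c = a * (x * y + y * z + z * x) ∧ d = -a * (x * y * z) := by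
  have h1 : a * (x ^ 2 + x * y + y ^ 2) + b * (x + y) + c = 0 :=
    mul_left_cancel₀ (sub_ne_zero.2 hxy) (by linear_combination hx - hy)
  have h2 : a * (x ^ 2 + x * z + z ^ 2) + b * (x + z) + c = 0 :=
    mul_left_cancel₀ (sub_ne_zero.2 hxz) (by linear_combination hx - hz)
  have h3 : a * (x + y + z) + b = 0 :=
    mul_left_cancel₀ (sub_ne_zero.2 hyz) (by linear_combination h1 - h2)
  have hb : b = -a * (x + y + z) := by linear_combination h3
  have hc : c = a * (x * y + y * z + z * x) := by linear_combination h1 - (x + y) * h3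
  exact ⟨hb, hc, by linear_combination hx - x ^ 2 * hb - x * hc⟩

/-- The cubic form `κ₀(y²z + x²z) + κ₁(z²x + y²x) + κ₂(x²y + z²y) - v·xyz`. -/
def cubicForm (κ₀ κ₁ κ₂ v x y z : F) : F :=
  κ₀ * (y ^ 2 * z + x ^ 2 * z) + κ₁ * (z ^ 2 * x + y ^ 2 * x) + κ₂ * (x ^ 2 * y + z ^ 2 * y) -
    v * (x * y * z)

/-- The polarisation of `cubicForm`: the coefficient of `t` in `cubicForm (x + t x', …)`. -/
def cubicPolar (κ₀ κ₁ κ₂ v x y z x' y' z' : F) : F :=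
  κ₀ * (2 * y * z * y' + y ^ 2 * z' + 2 * x * z * x' + x ^ 2 * z') +
    κ₁ * (2 * x * z * z' + z ^ 2 * x' + 2 * x * y * y' + y ^ 2 * x') +
    κ₂ * (2 * x * y * x' + x ^ 2 * y' + 2 * y * z * z' + z ^ 2 * y') -
    v * (x' * y * z + x * y' * z + x * y * z')

theorem cubicForm_add_mul (κ₀ κ₁ κ₂ v x y z x' y' z' t : F) :
    cubicForm κ₀ κ₁ κ₂ v (x + t * x') (y + t * y') (z + t * z') =
      cubicForm κ₀ κ₁ κ₂ v x' y' z' * t ^ 3 + cubicPolar κ₀ κ₁ κ₂ v x' y' z' x y z * t ^ 2 +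
        cubicPolar κ₀ κ₁ κ₂ v x y z x' y' z' * t + cubicForm κ₀ κ₁ κ₂ v x y z := by
  unfold cubicForm cubicPolar; ring

theorem cubicForm_rotate (κ₀ κ₁ κ₂ v x y z : F) :
    cubicForm κ₀ κ₁ κ₂ v z x y = cubicForm κ₁ κ₂ κ₀ v x y z := by
  unfold cubicForm; ring

theorem map_cubicForm (σ : F →+* F) (κ₀ κ₁ κ₂ v x y z : F) :
    σ (cubicForm κ₀ κ₁ κ₂ v x y z) = cubicForm (σ κ₀) (σ κ₁) (σ κ₂) (σ v) (σ x) (σ y) (σ z) := by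
  simp [cubicForm]

theorem map_cubicPolar (σ : F →+* F) (κ₀ κ₁ κ₂ v x y z x' y' z' : F) :
    σ (cubicPolar κ₀ κ₁ κ₂ v x y z x' y' z') =
      cubicPolar (σ κ₀) (σ κ₁) (σ κ₂) (σ v) (σ x) (σ y) (σ z) (σ x') (σ y') (σ z') := by
  simp [cubicPolar, map_ofNat]

theorem cubicPolar_rotate (κ₀ κ₁ κ₂ v x y z x' y' z' : F) :
    cubicPolar κ₀ κ₁ κ₂ v z x y z' x' y' = cubicPolar κ₁ κ₂ κ₀ v x y z x' y' z' := by
  unfold cubicPolar; ring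

theorem residual_of_three_roots {κ₀ κ₁ κ₂ v x y z x' y' z' t₀ t₁ t₂ : F}
    (h01 : t₀ ≠ t₁) (h02 : t₀ ≠ t₂) (h12 : t₁ ≠ t₂)
    (h₀ : cubicForm κ₀ κ₁ κ₂ v (x + t₀ * x') (y + t₀ * y') (z + t₀ * z') = 0)
    (h₁ : cubicForm κ₀ κ₁ κ₂ v (x + t₁ * x') (y + t₁ * y') (z + t₁ * z') = 0)
    (h₂ : cubicForm κ₀ κ₁ κ₂ v (x + t₂ * x') (y + t₂ * y') (z + t₂ * z') = 0)
    (hE : x * y' - y * x' ≠ 0) :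
    (x + t₀ * x') * (x + t₁ * x') * (x + t₂ * x') * (y * z' - z * y') *
        (κ₀ * (x * y' - y * x') - κ₁ * (y * z' - z * y')) =
      (y + t₀ * y') * (y + t₁ * y') * (y + t₂ * y') * (z * x' - x * z') *
        (κ₂ * (z * x' - x * z') - κ₀ * (x * y' - y * x')) := by
  rw [cubicForm_add_mul] at h₀ h₁ h₂
  obtain ⟨e2, e1, e0⟩ := cubic_coeffs_of_three_roots h01 h02 h12 h₀ h₁ h₂
  set k := cubicForm κ₀ κ₁ κ₂ v x' y' z' with hk
  have hx : k * ((x + t₀ * x') * (x + t₁ * x') * (x + t₂ * x')) =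
      (x * y' - y * x') * (z * x' - x * z') *
        (κ₂ * (z * x' - x * z') - κ₀ * (x * y' - y * x')) := by
    unfold cubicForm cubicPolar at *
    linear_combination x' ^ 3 * e0 - x * x' ^ 2 * e1 + x ^ 2 * x' * e2 + x ^ 3 * hk
  have hy : k * ((y + t₀ * y') * (y + t₁ * y') * (y + t₂ * y')) =
      (x * y' - y * x') * (y * z' - z * y') *
        (κ₀ * (x * y' - y * x') - κ₁ * (y * z' - z * y')) := by
    unfold cubicForm cubicPolar at *
    linear_combination y' ^ 3 * e0 - y * y' ^ 2 * e1 + y ^ 2 * y' * e2 + y ^ 3 * hk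
  refine mul_left_cancel₀ hE ?_
  linear_combination (y + t₀ * y') * (y + t₁ * y') * (y + t₂ * y') * hx -
    (x + t₀ * x') * (x + t₁ * x') * (x + t₂ * x') * hy

/-- `P = (w : 1 : s)` is a point of the cubic curve off the coordinate lines, collinear with its
images under the semilinear map `φ (x : y : z) = (σ z : σ x : σ y)`; the last condition compares the
intersections of the line with two of the coordinate lines. -/
structure IsCollinearTriple (σ : F →+* F) (κ v s w : F) : Prop where
  s_ne_zero : s ≠ 0
  w_ne_zero : w ≠ 0
  curve : (σ (σ κ) + κ * s) * w ^ 2 + (σ κ * (s ^ 2 + 1) - v * s) * w + s * (κ + σ (σ κ) * s) = 0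
  fst_ne_zero : 1 - s * σ w ≠ 0
  snd_ne_zero : s * σ s - w ≠ 0
  trd_ne_zero : w * σ w - σ s ≠ 0
  line : (1 - s * σ w) + (s * σ s - w) * σ (σ s) + (w * σ w - σ s) * σ (σ w) = 0
  residual : w * σ s * (1 - s * σ w) * (κ * (w * σ w - σ s) - σ κ * (1 - s * σ w)) =
    σ w * σ (σ s) * (s * σ s - w) * (σ (σ κ) * (s * σ s - w) - κ * (w * σ w - σ s))

variable {σ : F →+* F} {κ v : F}

theorem cubicForm_root_map (hs : ∀ x, σ (σ (σ x)) = x) (hv : σ v = v) {c d l : F}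
    (hroot : cubicForm κ (σ κ) (σ (σ κ)) v (c + l * d) (σ c + l * σ d)
      (σ (σ c) + l * σ (σ d)) = 0) :
    cubicForm κ (σ κ) (σ (σ κ)) v (c + σ l * d) (σ c + σ l * σ d)
      (σ (σ c) + σ l * σ (σ d)) = 0 := by
  have h := congrArg σ hroot
  rw [map_cubicForm, hs, map_zero, hv, ← cubicForm_rotate] at h
  simpa only [map_add, map_mul, hs] using h

theorem isCollinearTriple_of_root (hs : ∀ x, σ (σ (σ x)) = x) (hv : σ v = v)
    {c d l : F} (hE : c * σ d - σ c * d ≠ 0)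
    (hex : (σ (σ c) * d - c * σ (σ d)) * σ (σ κ) ≠ (σ c * σ (σ d) - σ (σ c) * σ d) * σ κ)
    (hl : σ l ≠ l)
    (hroot : cubicForm κ (σ κ) (σ (σ κ)) v (c + l * d) (σ c + l * σ d)
      (σ (σ c) + l * σ (σ d)) = 0) :
    IsCollinearTriple σ κ v ((σ (σ c) + l * σ (σ d)) / (σ c + l * σ d))
      ((c + l * d) / (σ c + l * σ d)) ∧
    (1 - (σ (σ c) + l * σ (σ d)) / (σ c + l * σ d) * σ ((c + l * d) / (σ c + l * σ d))) *
        (σ (σ c) * d - c * σ (σ d)) =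
      ((σ (σ c) + l * σ (σ d)) / (σ c + l * σ d) *
          σ ((σ (σ c) + l * σ (σ d)) / (σ c + l * σ d)) - (c + l * d) / (σ c + l * σ d)) *
        (σ c * σ (σ d) - σ (σ c) * σ d) := by
  have hE0 : σ c * σ (σ d) - σ (σ c) * σ d ≠ 0 := by
    simpa using (map_ne_zero σ).2 hE
  have hE1 : σ (σ c) * d - c * σ (σ d) ≠ 0 := by
    simpa [hs] using (map_ne_zero σ).2 hE0
  have hex' : (c * σ d - σ c * d) * κ ≠ (σ (σ c) * d - c * σ (σ d)) * σ (σ κ) := by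
    intro h; apply hex
    apply σ.injective
    simpa [hs] using h
  have hex2 : (σ c * σ (σ d) - σ (σ c) * σ d) * σ κ ≠ (c * σ d - σ c * d) * κ := by
    intro h; apply hex
    apply σ.injective; apply σ.injective
    simpa [hs] using h
  have hll : σ (σ l) ≠ σ l := fun h => hl (σ.injective h)
  have hll2 : l ≠ σ (σ l) := fun h => hll (by rw [← h]; exact (hs l ▸ congrArg σ h).symm)
  have hroot1 := cubicForm_root_map hs hv hroot
  have hroot2 := cubicForm_root_map hs hv hroot1
  have hres := residual_of_three_roots hl.symm hll2 hll.symm hroot hroot1 hroot2 hE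
  have hline : (σ c * σ (σ d) - σ (σ c) * σ d) * (c + l * d) +
      (σ (σ c) * d - c * σ (σ d)) * (σ c + l * σ d) +
      (c * σ d - σ c * d) * (σ (σ c) + l * σ (σ d)) = 0 := by ring
  have hxy : c + l * d = 0 → σ c + l * σ d ≠ 0 := fun h h' => hE (by
    linear_combination σ d * h - d * h')
  have hyz : σ c + l * σ d = 0 → σ (σ c) + l * σ (σ d) ≠ 0 := fun h h' => hE0 (by
    linear_combination σ (σ d) * h - σ d * h')
  have hzx : σ (σ c) + l * σ (σ d) = 0 → c + l * d ≠ 0 := fun h h' => hE1 (by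
    linear_combination d * h - σ (σ d) * h')
  have hx : c + l * d ≠ 0 := fun h => by
    have hz := fun h' => hzx h' h
    have h1 : κ * (σ c + l * σ d) + σ (σ κ) * (σ (σ c) + l * σ (σ d)) = 0 := by
      refine mul_left_cancel₀ (mul_ne_zero (hxy h) hz) ?_
      rw [cubicForm, h] at hroot
      linear_combination hroot
    refine hex' (mul_left_cancel₀ hz ?_)
    rw [h] at hline
    linear_combination κ * hline - (σ (σ c) * d - c * σ (σ d)) * h1
  have hy : σ c + l * σ d ≠ 0 := fun h => by
    have hx := fun h' => hxy h' h
    have h1 : κ * (c + l * d) + σ κ * (σ (σ c) + l * σ (σ d)) = 0 := by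
      refine mul_left_cancel₀ (mul_ne_zero hx (hyz h)) ?_
      rw [cubicForm, h] at hroot
      linear_combination hroot
    refine hex2 (mul_left_cancel₀ (hyz h) ?_)
    rw [h] at hline
    linear_combination (σ c * σ (σ d) - σ (σ c) * σ d) * h1 - κ * hline
  have hz : σ (σ c) + l * σ (σ d) ≠ 0 := fun h => by
    have hy := fun h' => hyz h' h
    have h1 : σ κ * (σ c + l * σ d) + σ (σ κ) * (c + l * d) = 0 := by
      refine mul_left_cancel₀ (mul_ne_zero (hzx h) hy) ?_
      rw [cubicForm, h] at hroot
      linear_combination hroot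
    refine hex (mul_left_cancel₀ hy ?_)
    rw [h] at hline
    linear_combination σ (σ κ) * hline - (σ c * σ (σ d) - σ (σ c) * σ d) * h1
  have hline2 : (σ c * σ (σ d) - σ (σ c) * σ d) * (c + σ (σ l) * d) +
      (σ (σ c) * d - c * σ (σ d)) * (σ c + σ (σ l) * σ d) +
      (c * σ d - σ c * d) * (σ (σ c) + σ (σ l) * σ (σ d)) = 0 := by ring
  have hll0 : σ l - l ≠ 0 := sub_ne_zero.2 hl
  set x := c + l * d with hxdef
  set y := σ c + l * σ d with hydef
  set z := σ (σ c) + l * σ (σ d) with hzdef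
  have hσx : σ x = σ c + σ l * σ d := by simp [hxdef]
  have hσy : σ y = σ (σ c) + σ l * σ (σ d) := by simp [hydef]
  have hσz : σ z = c + σ l * d := by simp [hzdef, hs]
  have hσy1 : σ y ≠ 0 := (map_ne_zero σ).2 hy
  have hσy2 : σ (σ y) ≠ 0 := (map_ne_zero σ).2 hσy1
  have hσσx : σ (σ x) = σ (σ c) + σ (σ l) * σ (σ d) := by simp [hxdef]
  have hσσy : σ (σ y) = c + σ (σ l) * d := by simp [hydef, hs]
  have hσσz : σ (σ z) = σ c + σ (σ l) * σ d := by simp [hzdef, hs]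
  rw [← hσx, ← hσz, ← hσσy, ← hσσz] at hres
  rw [← hσσx, ← hσσy, ← hσσz] at hline2
  have hfst : 1 - z / y * σ (x / y) =
      (σ l - l) * (σ c * σ (σ d) - σ (σ c) * σ d) / (y * σ y) := by
    rw [map_div₀, eq_div_iff (mul_ne_zero hy hσy1)]
    field_simp
    rw [hσx, hσy]
    linear_combination (σ (σ c) + σ l * σ (σ d)) * hydef - (σ c + σ l * σ d) * hzdef
  have hsnd : z / y * σ (z / y) - x / y =
      (σ l - l) * (σ (σ c) * d - c * σ (σ d)) / (y * σ y) := by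
    rw [map_div₀, eq_div_iff (mul_ne_zero hy hσy1)]
    field_simp
    rw [hσz, hσy]
    linear_combination (c + σ l * d) * hzdef - (σ (σ c) + σ l * σ (σ d)) * hxdef
  have htrd : x / y * σ (x / y) - σ (z / y) =
      (σ l - l) * (c * σ d - σ c * d) / (y * σ y) := by
    rw [map_div₀, map_div₀, eq_div_iff (mul_ne_zero hy hσy1)]
    field_simp
    rw [hσz, hσx]
    linear_combination (σ c + σ l * σ d) * hxdef - (c + σ l * d) * hydef
  refine ⟨⟨div_ne_zero hz hy, div_ne_zero hx hy, ?_, ?_, ?_, ?_, ?_, ?_⟩, ?_⟩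
  · unfold cubicForm at hroot
    field_simp
    linear_combination hroot
  · rw [hfst]
    exact div_ne_zero (mul_ne_zero hll0 hE0) (mul_ne_zero hy hσy1)
  · rw [hsnd]
    exact div_ne_zero (mul_ne_zero hll0 hE1) (mul_ne_zero hy hσy1)
  · rw [htrd]
    exact div_ne_zero (mul_ne_zero hll0 hE) (mul_ne_zero hy hσy1)
  · rw [hfst, hsnd, htrd]
    simp only [map_div₀]
    field_simp
    linear_combination (σ l - l) * hline2
  · rw [hfst, hsnd, htrd]
    simp only [map_div₀]
    field_simp
    linear_combination hres
  · rw [hfst, hsnd]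
    ring

theorem cubicForm_conj_fixed (hs : ∀ x, σ (σ (σ x)) = x) (hv : σ v = v) (c : F) :
    σ (cubicForm κ (σ κ) (σ (σ κ)) v c (σ c) (σ (σ c))) =
      cubicForm κ (σ κ) (σ (σ κ)) v c (σ c) (σ (σ c)) := by
  rw [map_cubicForm, hs, hs, hv, ← cubicForm_rotate]

theorem cubicPolar_conj_fixed (hs : ∀ x, σ (σ (σ x)) = x) (hv : σ v = v) (c d : F) :
    σ (cubicPolar κ (σ κ) (σ (σ κ)) v c (σ c) (σ (σ c)) d (σ d) (σ (σ d))) =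
      cubicPolar κ (σ κ) (σ (σ κ)) v c (σ c) (σ (σ c)) d (σ d) (σ (σ d)) := by
  rw [map_cubicPolar, hs, hs, hs, hv, ← cubicPolar_rotate]

variable [Fintype F] {q : ℕ}

theorem exists_three_collinearTriples (hF : Fintype.card F = q ^ 3) (hσ : ∀ x, σ x = x ^ q)
    (hq : 1 < q) (hv : σ v = v)
    (hG : ∀ c, c ≠ 0 → cubicForm κ (σ κ) (σ (σ κ)) v c (σ c) (σ (σ c)) ≠ 0)
    {e : F} (he : e ≠ 0) (hex : σ e * σ (σ κ) ≠ e * σ κ) :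
    ∃ T : Finset (F × F), #T = 3 ∧ ∀ P ∈ T, IsCollinearTriple σ κ v P.1 P.2 ∧
      (1 - P.1 * σ P.2) * σ e = (P.1 * σ P.1 - P.2) * e := by
  classical
  have hs := frobenius_iterate_three hF hσ
  obtain ⟨c, d, hc, hd, hE⟩ := exists_independent_of_trace_eq_zero hF hσ hq he
  have hE0 : σ c * σ (σ d) - σ (σ c) * σ d ≠ 0 := by
    simpa using (map_ne_zero σ).2 hE
  have heE : e * (σ (σ c) * d - c * σ (σ d)) = σ e * (σ c * σ (σ d) - σ (σ c) * σ d) := by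
    linear_combination σ (σ c) * hd - σ (σ d) * hc
  have hex' : (σ (σ c) * d - c * σ (σ d)) * σ (σ κ) ≠
      (σ c * σ (σ d) - σ (σ c) * σ d) * σ κ := fun h => hex (mul_left_cancel₀ hE0 (by
    linear_combination e * h - σ (σ κ) * heE))
  have hd0 : d ≠ 0 := by rintro rfl; simp at hE
  have hfix : ∀ x, σ x = x → cubicForm κ (σ κ) (σ (σ κ)) v d (σ d) (σ (σ d)) * x ^ 3 +
      cubicPolar κ (σ κ) (σ (σ κ)) v d (σ d) (σ (σ d)) c (σ c) (σ (σ c)) * x ^ 2 +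
        cubicPolar κ (σ κ) (σ (σ κ)) v c (σ c) (σ (σ c)) d (σ d) (σ (σ d)) * x +
          cubicForm κ (σ κ) (σ (σ κ)) v c (σ c) (σ (σ c)) ≠ 0 := by
    intro x hx
    rw [← cubicForm_add_mul]
    have h0 : c + x * d ≠ 0 := fun h0 => hE (by
      have h1 := congrArg σ h0
      rw [map_add, map_mul, hx, map_zero] at h1
      linear_combination σ d * h0 - d * h1)
    simpa [hx] using hG (c + x * d) h0
  obtain ⟨l, hl⟩ := exists_root_cubic hF hσ hq (hG d hd0) (cubicForm_conj_fixed hs hv d)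
    (cubicPolar_conj_fixed hs hv d c) (cubicPolar_conj_fixed hs hv c d)
    (cubicForm_conj_fixed hs hv c) hfix
  have hll : σ l ≠ l := fun h => hfix l h hl
  rw [← cubicForm_add_mul] at hl
  have hl1 := cubicForm_root_map hs hv hl
  have hl2 := cubicForm_root_map hs hv hl1
  have hll1 : σ (σ l) ≠ σ l := fun h => hll (σ.injective h)
  have hll2 : σ (σ (σ l)) ≠ σ (σ l) := fun h => hll1 (σ.injective h)
  have hmem : ∀ t ∈ ({l, σ l, σ (σ l)} : Finset F), σ t ≠ t ∧
      cubicForm κ (σ κ) (σ (σ κ)) v (c + t * d) (σ c + t * σ d) (σ (σ c) + t * σ (σ d)) = 0 := by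
    intro t ht
    simp only [Finset.mem_insert, Finset.mem_singleton] at ht
    rcases ht with rfl | rfl | rfl
    exacts [⟨hll, hl⟩, ⟨hll1, hl1⟩, ⟨hll2, hl2⟩]
  refine ⟨({l, σ l, σ (σ l)} : Finset F).image fun t =>
    ((σ (σ c) + t * σ (σ d)) / (σ c + t * σ d), (c + t * d) / (σ c + t * σ d)), ?_, ?_⟩
  · rw [Finset.card_image_of_injOn, Finset.card_eq_three.2 ⟨l, σ l, σ (σ l), hll.symm,
      fun h => hll2 (by rw [hs, ← h]), hll1.symm, rfl⟩]
    intro t ht t' ht' h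
    have hz := (isCollinearTriple_of_root hs hv hE hex' (hmem t ht).1 (hmem t ht).2).1.s_ne_zero
    have hz' := (isCollinearTriple_of_root hs hv hE hex' (hmem t' ht').1
      (hmem t' ht').2).1.s_ne_zero
    have h1 := congrArg Prod.fst h
    simp only at h1
    rw [div_eq_div_iff (div_ne_zero_iff.1 hz).2 (div_ne_zero_iff.1 hz').2] at h1
    exact mul_left_cancel₀ hE0 (by linear_combination h1)
  · intro P hP
    obtain ⟨t, ht, rfl⟩ := Finset.mem_image.1 hP
    obtain ⟨h1, h2⟩ := isCollinearTriple_of_root hs hv hE hex' (hmem t ht).1 (hmem t ht).2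
    refine ⟨h1, mul_left_cancel₀ hE0 ?_⟩
    linear_combination e * h2 - (1 - (σ (σ c) + t * σ (σ d)) / (σ c + t * σ d) *
      σ ((c + t * d) / (σ c + t * σ d))) * heE

open Classical in
theorem le_card_collinearTriples (hF : Fintype.card F = q ^ 3) (hσ : ∀ x, σ x = x ^ q)
    (hq : 1 < q) (hκ : κ ≠ 0) (hv : σ v = v)
    (hG : ∀ c, c ≠ 0 → cubicForm κ (σ κ) (σ (σ κ)) v c (σ c) (σ (σ c)) ≠ 0) :
    3 * (q ^ 2 + q) ≤ #{P : F × F | IsCollinearTriple σ κ v P.1 P.2} := by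
  have hmul : (q - 1) * (q ^ 2 + q + 1) = q ^ 3 - 1 := by
    obtain ⟨n, rfl⟩ := Nat.exists_eq_add_of_lt hq
    rw [show 1 + n + 1 - 1 = n + 1 by omega]
    exact (Nat.sub_eq_of_eq_add (by ring)).symm
  have hR := le_card_image_pow hF (by omega) hmul
  set R := ({x : F | x ≠ 0} : Finset F).image (· ^ (q - 1))
  have hR' := Finset.pred_card_le_card_erase (s := R) (a := σ κ / σ (σ κ))
  have key := Finset.mul_card_image_le_card_of_maps_to
    (s := ({P : F × F | IsCollinearTriple σ κ v P.1 P.2} : Finset (F × F)).filter fun P =>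
      (P.1 * σ P.1 - P.2) / (1 - P.1 * σ P.2) ∈ R.erase (σ κ / σ (σ κ)))
    (t := R.erase (σ κ / σ (σ κ)))
    (f := fun P => (P.1 * σ P.1 - P.2) / (1 - P.1 * σ P.2))
    (fun P hP => (Finset.mem_filter.1 hP).2) 3 fun r hr => by
      obtain ⟨hr0, hrR⟩ := Finset.mem_erase.1 hr
      obtain ⟨e, he, rfl⟩ := Finset.mem_image.1 hrR
      have he : e ≠ 0 := (Finset.mem_filter.1 he).2
      have hpow : e ^ (q - 1) = σ e / e := by
        rw [hσ, eq_div_iff he, ← pow_succ, Nat.sub_add_cancel hq.le]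
      simp only [hpow] at hr0 hr ⊢
      have hκ2 : σ (σ κ) ≠ 0 := (map_ne_zero σ).2 ((map_ne_zero σ).2 hκ)
      obtain ⟨T, hT, hT'⟩ := exists_three_collinearTriples (κ := κ) hF hσ hq hv hG he fun h =>
        hr0 (by rw [div_eq_div_iff he hκ2]; linear_combination h)
      rw [← hT]
      refine Finset.card_le_card fun P hP => ?_
      obtain ⟨h1, h2⟩ := hT' P hP
      have h3 : (P.1 * σ P.1 - P.2) / (1 - P.1 * σ P.2) = σ e / e := by
        rw [div_eq_div_iff h1.fst_ne_zero he]; linear_combination -h2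
      simp only [Finset.mem_filter, Finset.mem_univ, true_and]
      exact ⟨⟨h1, h3 ▸ hr⟩, h3⟩
  have := key.trans (Finset.card_le_card (Finset.filter_subset _ _))
  omega

end CollinearTriples

section QuadraticCover

open Polynomial Finset

variable {F : Type*} [Field F]

theorem card_le_natDegree_of_quadratic_of_linear {a b c A B : F[X]}
    (hn : a * A ^ 2 - b * A * B + c * B ^ 2 ≠ 0) (S : Finset (F × F))
    (ha : ∀ P ∈ S, a.eval P.1 ≠ 0)
    (hS : ∀ P ∈ S, a.eval P.1 * P.2 ^ 2 + b.eval P.1 * P.2 + c.eval P.1 = 0)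
    (hAB : ∀ P ∈ S, A.eval P.1 + B.eval P.1 * P.2 = 0) :
    #S ≤ (a * A ^ 2 - b * A * B + c * B ^ 2).natDegree := by
  classical
  set n := a * A ^ 2 - b * A * B + c * B ^ 2 with hn_def
  have hroot : ∀ P ∈ S, n.eval P.1 = 0 := by
    intro P hP
    simp only [hn_def, eval_add, eval_sub, eval_mul, eval_pow]
    linear_combination B.eval P.1 ^ 2 * hS P hP +
      (a.eval P.1 * A.eval P.1 - a.eval P.1 * B.eval P.1 * P.2 - b.eval P.1 * B.eval P.1) *
        hAB P hP
  rw [Finset.card_eq_sum_card_fiberwise (f := Prod.fst) (t := n.roots.toFinset)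
    fun P hP => by simpa [hn] using hroot P hP]
  refine le_trans (Finset.sum_le_sum fun s _ => ?_)
    ((Multiset.toFinset_sum_count_eq n.roots).le.trans (card_roots' n))
  rcases Nat.lt_or_ge 1 #{P ∈ S | P.1 = s} with h1 | h1
  · obtain ⟨P, hP, Q, hQ, hPQ⟩ := Finset.one_lt_card.1 h1
    obtain ⟨hPS, rfl⟩ := Finset.mem_filter.1 hP
    obtain ⟨hQS, hQs⟩ := Finset.mem_filter.1 hQ
    have hne : P.2 - Q.2 ≠ 0 := sub_ne_zero.2 fun h => hPQ (Prod.ext hQs.symm h)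
    have hP2 := hAB P hPS
    have hQ2 := hAB Q hQS
    rw [hQs] at hQ2
    have hB : B.eval P.1 = 0 := mul_left_cancel₀ hne (by linear_combination hP2 - hQ2)
    have hA : A.eval P.1 = 0 := by linear_combination hP2 - P.2 * hB
    obtain ⟨A', rfl⟩ := dvd_iff_isRoot.2 hA
    obtain ⟨B', rfl⟩ := dvd_iff_isRoot.2 hB
    rw [count_roots]
    refine le_trans ?_ ((le_rootMultiplicity_iff hn).2
      (show (X - C P.1) ^ 2 ∣ n from ⟨a * A' ^ 2 - b * A' * B' + c * B' ^ 2, by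
        rw [hn_def]; ring⟩))
    by_contra! h2
    obtain ⟨u, v, w, hu, hv, hw, huv, huw, hvw⟩ := Finset.two_lt_card_iff.1 h2
    obtain ⟨huS, hus⟩ := Finset.mem_filter.1 hu
    obtain ⟨hvS, hvs⟩ := Finset.mem_filter.1 hv
    obtain ⟨hwS, hws⟩ := Finset.mem_filter.1 hw
    have h3 := hS u huS
    have h4 := hS v hvS
    have h5 := hS w hwS
    rw [hus] at h3
    rw [hvs] at h4
    rw [hws] at h5
    have huv' : u.2 - v.2 ≠ 0 := sub_ne_zero.2 fun h => huv (Prod.ext (hus.trans hvs.symm) h)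
    have huw' : u.2 - w.2 ≠ 0 := sub_ne_zero.2 fun h => huw (Prod.ext (hus.trans hws.symm) h)
    have hvw' : v.2 - w.2 ≠ 0 := sub_ne_zero.2 fun h => hvw (Prod.ext (hvs.trans hws.symm) h)
    refine ha P hPS (mul_left_cancel₀ (mul_ne_zero huv' (mul_ne_zero huw' hvw')) ?_)
    linear_combination (v.2 - w.2) * h3 - (u.2 - w.2) * h4 + (u.2 - v.2) * h5
  · rcases Finset.eq_empty_or_nonempty {P ∈ S | P.1 = s} with h0 | ⟨P, hP⟩
    · simp [h0]
    · obtain ⟨hPS, rfl⟩ := Finset.mem_filter.1 hP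
      exact h1.trans (Multiset.one_le_count_iff_mem.2 ((mem_roots hn).2 (hroot P hPS)))

/-- The coefficients `(A, B)` with `aᵏ wᵏ⁺¹ = A + B w` modulo `a w² + b w + c`. -/
noncomputable def reducedPow (a b c : F[X]) : ℕ → F[X] × F[X]
  | 0 => (0, 1)
  | k + 1 => (-c * (reducedPow a b c k).2,
      a * (reducedPow a b c k).1 - b * (reducedPow a b c k).2)

theorem eval_reducedPow {a b c : F[X]} {s w : F}
    (h : a.eval s * w ^ 2 + b.eval s * w + c.eval s = 0) (k : ℕ) :
    a.eval s ^ k * w ^ (k + 1) =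
      (reducedPow a b c k).1.eval s + (reducedPow a b c k).2.eval s * w := by
  induction k with
  | zero => simp [reducedPow]
  | succ k ih =>
    simp only [reducedPow, eval_mul, eval_sub, eval_neg]
    linear_combination a.eval s * w * ih + (reducedPow a b c k).2.eval s * h

theorem natDegree_reducedPow {a b c : F[X]} (ha : a.natDegree ≤ 1) (hb : b.natDegree ≤ 2)
    (hc : c.natDegree ≤ 2) (k : ℕ) :
    (reducedPow a b c k).1.natDegree ≤ 2 * k ∧ (reducedPow a b c k).2.natDegree ≤ 2 * k := by
  induction k with
  | zero => simp [reducedPow]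
  | succ k ih =>
    refine ⟨(natDegree_mul_le_of_le ((natDegree_neg c).le.trans hc) ih.2).trans (by omega), ?_⟩
    exact (natDegree_sub_le_of_le (natDegree_mul_le_of_le ha ih.1)
      (natDegree_mul_le_of_le hb ih.2)).trans (by omega)

theorem eval_zero_reducedPow {a b c : F[X]} (hc : c.eval 0 = 0) (k : ℕ) :
    (reducedPow a b c k).1.eval 0 = 0 := by
  cases k <;> simp [reducedPow, hc]

end QuadraticCover

section ResidualPolynomials

open Polynomial Finset

variable {F : Type*} [Field F]

/-- The coefficients of the cubic curve in the chart `(w : 1 : s)`, as a quadratic in `w`. -/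
noncomputable def leadPoly (κ₀ κ₂ : F) : F[X] := C κ₂ + C κ₀ * X

/-- See `leadPoly`. -/
noncomputable def midPoly (κ₁ v : F) : F[X] := C κ₁ * (X ^ 2 + 1) - C v * X

/-- See `leadPoly`. -/
noncomputable def constPoly (κ₀ κ₂ : F) : F[X] := X * (C κ₀ + C κ₂ * X)

/-- The constant coefficient of the residual equation of `IsCollinearTriple`, reduced to a linear
equation in `w` modulo `a w² + b w + c`. -/
noncomputable def residualFst (a b c : F[X]) (κ₀ κ₁ κ₂ : F) (q : ℕ) : F[X] :=
  X ^ q ^ 2 * (C κ₀ * (reducedPow a b c q).1 - a ^ q * X ^ (q - 1) * c -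
      a ^ q * C κ₂ * X ^ (q + 1) - a ^ q * X ^ (2 * q) * b -
      C κ₀ * X ^ (q + 1) * a * (reducedPow a b c (q - 1)).1) +
    (C κ₀ * X ^ (q + 1) * (reducedPow a b c q).1 +
      C κ₁ * X ^ (q + 2) * a * (reducedPow a b c (q - 1)).1 +
      X * a * (reducedPow a b c (2 * q - 1)).1 + X * b ^ q * a * (reducedPow a b c (q - 1)).1 -
      a ^ q * C κ₁ * X ^ (q + 1) - a ^ (q + 1) * (reducedPow a b c (q - 1)).1 - a ^ q * b ^ q)

/-- The coefficient of `w` in the residual equation, see `residualFst`. -/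
noncomputable def residualSnd (a b c : F[X]) (κ₀ κ₁ κ₂ : F) (q : ℕ) : F[X] :=
  X ^ q ^ 2 * (C κ₀ * (reducedPow a b c q).2 + a ^ q * C κ₂ - a ^ (q + 1) * X ^ (2 * q) -
      C κ₀ * X ^ (q + 1) * a * (reducedPow a b c (q - 1)).2) +
    (C κ₀ * X ^ (q + 1) * (reducedPow a b c q).2 +
      C κ₁ * X ^ (q + 2) * a * (reducedPow a b c (q - 1)).2 +
      X * a * (reducedPow a b c (2 * q - 1)).2 + X * b ^ q * a * (reducedPow a b c (q - 1)).2 -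
      C κ₀ * X ^ q * a ^ q - a ^ (q + 1) * (reducedPow a b c (q - 1)).2)

theorem natDegree_residual_le {a b c : F[X]} (ha : a.natDegree ≤ 1) (hb : b.natDegree ≤ 2)
    (hc : c.natDegree ≤ 2) (κ₀ κ₁ κ₂ : F) {q : ℕ} (hq : 0 < q) :
    (residualFst a b c κ₀ κ₁ κ₂ q).natDegree ≤ q ^ 2 + 3 * q + 2 ∧
      (residualSnd a b c κ₀ κ₁ κ₂ q).natDegree ≤ q ^ 2 + 3 * q + 1 := by
  have hX (n : ℕ) : (X ^ n : F[X]).natDegree ≤ n := natDegree_X_pow_le n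
  have hC (k : F) : (C k).natDegree ≤ 0 := (natDegree_C k).le
  have haq (n : ℕ) : (a ^ n).natDegree ≤ n * 1 := natDegree_pow_le_of_le n ha
  have hbq (n : ℕ) : (b ^ n).natDegree ≤ n * 2 := natDegree_pow_le_of_le n hb
  have hR n := (natDegree_reducedPow ha hb hc n).1
  have hR' n := (natDegree_reducedPow ha hb hc n).2
  have hsub {f g : F[X]} {m n : ℕ} (hf : f.natDegree ≤ m) (hg : g.natDegree ≤ n) :
    (f - g).natDegree ≤ max m n := natDegree_sub_le_of_le hf hg
  have hq2 : q ≤ q ^ 2 := Nat.le_self_pow two_ne_zero q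
  rw [residualFst, residualSnd]
  generalize q ^ 2 = Q at *
  constructor
  all_goals
    apply le_trans
    · with_reducible repeat' first
        | exact hX _ | exact hC _ | exact haq _ | exact hbq _ | exact hR _ | exact hR' _
        | exact ha | exact hb | exact hc | exact natDegree_X_le
        | apply natDegree_add_le_of_le | apply hsub
        | apply natDegree_mul_le_of_le
    · omega

theorem IsCollinearTriple.eval_residual {σ : F →+* F} {κ v s w : F} {q : ℕ} (hq : 0 < q)
    (hσ : ∀ x, σ x = x ^ q) (hs : ∀ x, σ (σ (σ x)) = x)
    (h : IsCollinearTriple σ κ v s w) :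
    (residualFst (leadPoly κ (σ (σ κ))) (midPoly (σ κ) v) (constPoly κ (σ (σ κ)))
        κ (σ κ) (σ (σ κ)) q).eval s +
      (residualSnd (leadPoly κ (σ (σ κ))) (midPoly (σ κ) v) (constPoly κ (σ (σ κ)))
        κ (σ κ) (σ (σ κ)) q).eval s * w = 0 := by
  obtain ⟨r, rfl⟩ : ∃ r, q = r + 1 := ⟨q - 1, by omega⟩
  have ha : (leadPoly κ (σ (σ κ))).eval s = σ (σ κ) + κ * s := by simp [leadPoly]
  have hb : (midPoly (σ κ) v).eval s = σ κ * (s ^ 2 + 1) - v * s := by simp [midPoly]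
  have hc : (constPoly κ (σ (σ κ))).eval s = s * (κ + σ (σ κ) * s) := by simp [constPoly]
  have hcurve := h.curve
  rw [← ha, ← hb, ← hc] at hcurve
  have hR := eval_reducedPow hcurve
  have h1 := hR r
  have h2 := hR (r + 1)
  have h3 := hR (2 * r + 1)
  have hsw := mul_ne_zero h.w_ne_zero ((map_ne_zero σ).2 h.w_ne_zero)
  have hres := h.residual
  have hcurve' := congrArg σ hcurve
  simp only [map_add, map_mul, map_pow, map_zero] at hcurve'
  have hcσ : σ ((constPoly κ (σ (σ κ))).eval s) = σ s * (σ κ + κ * σ s) := by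
    rw [hc]; simp [hs]
  rw [hcσ] at hcurve'
  have hL : σ s = s ^ r * s := by rw [hσ, pow_succ]
  have key : σ (σ s) * (w - s * σ s) * (σ (σ κ) + s ^ r * ((leadPoly κ (σ (σ κ))).eval s * w +
      (midPoly (σ κ) v).eval s) + κ * σ w) + (s * σ w - 1) * (κ * σ s * w + σ κ * s * σ s +
        (σ ((leadPoly κ (σ (σ κ))).eval s) * σ w + σ ((midPoly (σ κ) v).eval s))) = 0 := by
    refine mul_left_cancel₀ hsw ?_
    linear_combination -hres - w * (1 - s * σ w) * hcurve' -
      σ w * σ (σ s) * (s * σ s - w) * (s ^ r * hcurve + (σ (σ κ) * s + κ) * hL -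
        s ^ r * hc)
  rw [hσ ((leadPoly κ (σ (σ κ))).eval s), hσ ((midPoly (σ κ) v).eval s), hσ w, hσ (σ s), hσ s]
    at key
  simp only [residualFst, residualSnd, eval_add, eval_sub, eval_mul, eval_pow, eval_X, eval_C,
    Nat.add_sub_cancel, show 2 * (r + 1) - 1 = 2 * r + 1 by omega]
  rw [← pow_mul, ← sq] at key
  generalize (r + 1) ^ 2 = Q at *
  generalize (leadPoly κ (σ (σ κ))).eval s = a at *
  generalize (midPoly (σ κ) v).eval s = b at *
  generalize (constPoly κ (σ (σ κ))).eval s = c at *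
  linear_combination a ^ (r + 1) * key - (κ * s ^ Q + κ * s ^ (r + 2)) * h2 -
    (-s ^ Q * κ * s ^ (r + 2) * a + σ κ * s ^ (r + 3) * a + s * b ^ (r + 1) * a -
      a ^ (r + 2)) * h1 - s * a * h3 - s ^ Q * a ^ (r + 1) * s ^ r * hcurve

end ResidualPolynomials

section Discriminant

open Polynomial Finset

variable {F : Type*} [Field F]

theorem exists_sq_eq_discrim {a b c A B : F[X]} (ha : a ≠ 0) (hA : A ≠ 0)
    (h : a * A ^ 2 - b * A * B + c * B ^ 2 = 0) : ∃ E, b ^ 2 - 4 * a * c = E ^ 2 := by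
  have hB : B ≠ 0 := by
    rintro rfl
    exact mul_ne_zero ha (pow_ne_zero 2 hA) (by linear_combination h)
  have h1 : (2 * a * A - b * B) ^ 2 = (b ^ 2 - 4 * a * c) * B ^ 2 := by
    linear_combination 4 * a * h
  obtain ⟨E, hE⟩ := (UniqueFactorizationMonoid.pow_dvd_pow_iff_dvd two_ne_zero).1
    (Dvd.intro_left _ h1.symm)
  refine ⟨E, mul_right_cancel₀ (pow_ne_zero 2 hB) ?_⟩
  rw [← h1, hE]; ring

theorem degenerate_of_discrim_eq_sq (h2 : (2 : F) ≠ 0) {κ₀ κ₁ κ₂ v : F} (hκ₁ : κ₁ ≠ 0) {E : F[X]}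
    (hE : midPoly κ₁ v ^ 2 - 4 * leadPoly κ₀ κ₂ * constPoly κ₀ κ₂ = E ^ 2) :
    v * κ₀ * κ₁ * κ₂ + κ₀ ^ 2 * κ₂ ^ 2 + κ₀ ^ 2 * κ₁ ^ 2 + κ₂ ^ 2 * κ₁ ^ 2 = 0 ∨
      (v * κ₁ = -2 * (κ₀ * κ₂) ∧ (κ₁ ^ 2 - κ₀ ^ 2) * (κ₁ ^ 2 - κ₂ ^ 2) = 0) := by
  have hdisc : midPoly κ₁ v ^ 2 - 4 * leadPoly κ₀ κ₂ * constPoly κ₀ κ₂ =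
      C (κ₁ ^ 2) * X ^ 4 + C (-2 * κ₁ * v - 4 * κ₀ * κ₂) * X ^ 3 +
        C (v ^ 2 + 2 * κ₁ ^ 2 - 4 * (κ₀ ^ 2 + κ₂ ^ 2)) * X ^ 2 +
          C (-2 * κ₁ * v - 4 * κ₀ * κ₂) * X + C (κ₁ ^ 2) := by
    simp only [midPoly, leadPoly, constPoly, map_sub, map_add, map_mul, map_neg, map_pow,
      map_ofNat]
    ring
  have hdeg : E.natDegree ≤ 2 := by
    have h := congrArg natDegree hE
    rw [natDegree_pow, hdisc] at h
    have : (C (κ₁ ^ 2) * X ^ 4 + C (-2 * κ₁ * v - 4 * κ₀ * κ₂) * X ^ 3 +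
        C (v ^ 2 + 2 * κ₁ ^ 2 - 4 * (κ₀ ^ 2 + κ₂ ^ 2)) * X ^ 2 +
          C (-2 * κ₁ * v - 4 * κ₀ * κ₂) * X + C (κ₁ ^ 2)).natDegree ≤ 4 := by
      compute_degree
    omega
  have hE' : E = C (E.coeff 2) * X ^ 2 + C (E.coeff 1) * X + C (E.coeff 0) := by
    conv_lhs => rw [E.as_sum_range_C_mul_X_pow' (show E.natDegree < 3 by omega)]
    simp only [Finset.sum_range_succ, Finset.sum_range_zero]
    ring
  set e₀ := E.coeff 0
  set e₁ := E.coeff 1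
  set e₂ := E.coeff 2
  have hsq : E ^ 2 = C (e₂ ^ 2) * X ^ 4 + C (2 * e₁ * e₂) * X ^ 3 +
      C (e₁ ^ 2 + 2 * e₀ * e₂) * X ^ 2 + C (2 * e₀ * e₁) * X + C (e₀ ^ 2) := by
    rw [hE']
    simp only [map_add, map_mul, map_pow, map_ofNat]
    ring
  rw [hdisc, hsq] at hE
  have c4 := congrArg (coeff · 4) hE
  have c3 := congrArg (coeff · 3) hE
  have c2 := congrArg (coeff · 2) hE
  have c1 := congrArg (coeff · 1) hE
  have c0 := congrArg (coeff · 0) hE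
  simp only [coeff_add, coeff_C_mul, coeff_X_pow, coeff_X, coeff_C] at c4 c3 c2 c1 c0
  norm_num at c4 c3 c2 c1 c0
  have h4 : (4 : F) ≠ 0 := by
    rw [show (4 : F) = 2 * 2 by norm_num]; exact mul_ne_zero h2 h2
  have he₂ : e₂ ≠ 0 := by
    rintro h
    exact hκ₁ (pow_eq_zero_iff two_ne_zero |>.1 (by rw [c4, h]; ring))
  have h02 : (e₀ - e₂) * (e₀ + e₂) = 0 := by linear_combination c4 - c0
  rcases mul_eq_zero.1 h02 with h | h
  · left
    have h : e₀ = e₂ := by linear_combination h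
    rw [h] at c1 c2
    have h5 : e₁ ^ 2 = v ^ 2 - 4 * (κ₀ ^ 2 + κ₂ ^ 2) := by linear_combination -c2 + 2 * c4
    have h6 : e₂ * e₁ = -(κ₁ * v + 2 * κ₀ * κ₂) :=
      mul_left_cancel₀ h2 (by linear_combination -c3)
    refine mul_left_cancel₀ h4 ?_
    linear_combination (-e₂ * e₁ + (κ₁ * v + 2 * κ₀ * κ₂)) * h6 - e₁ ^ 2 * c4 + κ₁ ^ 2 * h5
  · right
    have h : e₀ = -e₂ := by linear_combination h
    rw [h] at c1 c2
    have h6 : e₁ = 0 := mul_left_cancel₀ (mul_ne_zero h4 he₂) (by linear_combination c1 - c3)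
    rw [h6] at c2 c3
    have h7 : v * κ₁ = -2 * (κ₀ * κ₂) := mul_left_cancel₀ h2 (by linear_combination -c3)
    refine ⟨h7, mul_left_cancel₀ h4 ?_⟩
    linear_combination (2 * κ₁ ^ 2) * c4 + κ₁ ^ 2 * c2 - (v * κ₁ - 2 * (κ₀ * κ₂)) * h7

end Discriminant

section CollinearTripleCount

open Polynomial Finset

variable {F : Type*} [Field F] {σ : F →+* F} {κ v : F}

theorem coeffs_not_all_zero (h2 : (2 : F) ≠ 0) (hs : ∀ x, σ (σ (σ x)) = x) (hκ : κ ≠ 0)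
    (hne : ¬(σ κ = κ ∧ v = -2 * κ)) {s : F} (hs0 : s ≠ 0) (ha : σ (σ κ) + κ * s = 0)
    (hb : σ κ * (s ^ 2 + 1) - v * s = 0) : s * (κ + σ (σ κ) * s) ≠ 0 := by
  intro hc
  have hc : κ + σ (σ κ) * s = 0 := (mul_eq_zero.1 hc).resolve_left hs0
  have h1 : (s - 1) * (s + 1) = 0 := mul_left_cancel₀ hκ (by linear_combination s * ha - hc)
  rcases mul_eq_zero.1 h1 with h | h
  · have h3 : σ (σ κ) = -κ := by linear_combination ha - κ * h
    have h4 : σ κ = κ := by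
      rw [← hs (σ κ), h3, map_neg, map_neg, h3, neg_neg]
    rw [h4, h4] at h3
    exact mul_ne_zero h2 hκ (by linear_combination h3)
  · have h3 : σ (σ κ) = κ := by linear_combination ha - κ * h
    have h4 : σ κ = κ := by rw [← h3, hs, h3]
    refine hne ⟨h4, ?_⟩
    rw [h4] at hb
    have h5 : s = -1 := by linear_combination h
    rw [h5] at hb
    linear_combination hb

theorem curve_inv {κ₀ κ₁ κ₂ v s w : F} (hs : s ≠ 0) (hw : w ≠ 0)
    (h : (κ₂ + κ₀ * s) * w ^ 2 + (κ₁ * (s ^ 2 + 1) - v * s) * w + s * (κ₀ + κ₂ * s) = 0) :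
    (κ₂ + κ₀ * s⁻¹) * w⁻¹ ^ 2 + (κ₁ * (s⁻¹ ^ 2 + 1) - v * s⁻¹) * w⁻¹ +
      s⁻¹ * (κ₀ + κ₂ * s⁻¹) = 0 := by
  field_simp
  linear_combination h

theorem IsCollinearTriple.not_inv (hs : ∀ x, σ (σ (σ x)) = x) {s w : F}
    (h : IsCollinearTriple σ κ v s w) : ¬IsCollinearTriple σ κ v s⁻¹ w⁻¹ := by
  intro h'
  obtain ⟨hs0, hw0, -, hY0, hY1, hY2, hline, -⟩ := h
  have hZ1 := h'.snd_ne_zero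
  have hline' := h'.line
  set Y₀ := 1 - s * σ w with hY₀
  set Y₁ := s * σ s - w with hY₁
  set Y₂ := w * σ w - σ s with hY₂
  set Z₀ := 1 - s⁻¹ * σ w⁻¹ with hZ₀
  set Z₁ := s⁻¹ * σ s⁻¹ - w⁻¹ with hZ₁
  set Z₂ := w⁻¹ * σ w⁻¹ - σ s⁻¹ with hZ₂
  have hsσ := (map_ne_zero σ).2 hs0
  have hwσ := (map_ne_zero σ).2 hw0
  have hsσσ := (map_ne_zero σ).2 hsσ
  have hwσσ := (map_ne_zero σ).2 hwσ
  have key {x y z : F} (hy : y ≠ 0) (hl : Y₀ * x + Y₁ * y + Y₂ * z = 0)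
      (hc : Z₀ * y * z + Z₁ * x * z + Z₂ * x * y = 0) :
      (0 : F) * (z / y) ^ 3 + Z₁ * Y₂ * (z / y) ^ 2 + (Z₁ * Y₁ + Z₂ * Y₂ - Y₀ * Z₀) * (z / y) +
        Z₂ * Y₁ = 0 := by
    obtain ⟨t, rfl⟩ : ∃ t, z = t * y := ⟨z / y, (div_mul_cancel₀ z hy).symm⟩
    rw [mul_div_cancel_right₀ t hy]
    refine mul_left_cancel₀ (pow_ne_zero 2 hy) ?_
    linear_combination (Z₁ * t * y + Z₂ * y) * hl - Y₀ * hc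
  have k1 := key (x := w) (y := 1) (z := s) one_ne_zero (by rw [hY₀, hY₁, hY₂]; ring)
    (by rw [hZ₀, hZ₁, hZ₂]; simp only [map_inv₀]; field_simp; ring)
  have k2 := key (x := σ s) (y := σ w) (z := 1) hwσ (by rw [hY₀, hY₁, hY₂]; ring)
    (by rw [hZ₀, hZ₁, hZ₂]; simp only [map_inv₀]; field_simp; ring)
  have k3 := key (x := 1) (y := σ (σ s)) (z := σ (σ w)) hsσσ (by linear_combination hline)
    (by
      simp only [map_inv₀] at hline'
      field_simp at hline'
      linear_combination hline')
  have hd12 : s / 1 ≠ 1 / σ w := by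
    intro h
    field_simp at h
    exact hY0 (by rw [hY₀]; linear_combination -h)
  have hd13 : s / 1 ≠ σ (σ w) / σ (σ s) := by
    intro h
    field_simp at h
    refine (map_ne_zero σ).2 ((map_ne_zero σ).2 hY1) ?_
    rw [hY₁]
    simp only [map_sub, map_mul, hs]
    linear_combination h
  have hd23 : 1 / σ w ≠ σ (σ w) / σ (σ s) := by
    intro h
    field_simp at h
    refine (map_ne_zero σ).2 hY2 ?_
    rw [hY₂]
    simp only [map_sub, map_mul]
    linear_combination -h
  exact mul_ne_zero hZ1 hY2 (by
    simpa using (cubic_coeffs_of_three_roots hd12 hd13 hd23 k1 k2 k3).1)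

theorem card_quadratic_roots_le [Fintype F] [DecidableEq F] {a b c : F}
    (h : ¬(a = 0 ∧ b = 0 ∧ c = 0)) : #{x : F | a * x ^ 2 + b * x + c = 0} ≤ 2 := by
  set P : F[X] := C a * X ^ 2 + C b * X + C c with hP
  have hP0 : P ≠ 0 := by
    intro h0
    have e0 := congrArg (coeff · 0) h0
    have e1 := congrArg (coeff · 1) h0
    have e2 := congrArg (coeff · 2) h0
    simp [hP, coeff_X, coeff_C] at e0 e1 e2
    exact h ⟨e2, e1, e0⟩
  calc #{x : F | a * x ^ 2 + b * x + c = 0} ≤ #P.roots.toFinset := card_le_card fun x hx => by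
        rw [Multiset.mem_toFinset, mem_roots hP0]
        simpa [hP] using hx
    _ ≤ P.natDegree := P.roots.toFinset_card_le.trans P.card_roots'
    _ ≤ 2 := natDegree_quadratic_le

open Classical in
theorem card_collinearTriples_le [Fintype F] (h2 : (2 : F) ≠ 0) (hs : ∀ x, σ (σ (σ x)) = x)
    (hκ : κ ≠ 0) (hne : ¬(σ κ = κ ∧ v = -2 * κ)) :
    #{P : F × F | IsCollinearTriple σ κ v P.1 P.2} ≤ Fintype.card F - 1 := by
  set S : Finset (F × F) := {P : F × F | IsCollinearTriple σ κ v P.1 P.2} with hS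
  set T : Finset (F × F) := {P : F × F | IsCollinearTriple σ κ v P.1⁻¹ P.2⁻¹} with hT
  have hST : #S = #T := Finset.card_nbij' (fun P => (P.1⁻¹, P.2⁻¹)) (fun P => (P.1⁻¹, P.2⁻¹))
    (fun P hP => by simpa [hS, hT] using hP) (fun P hP => by simpa [hS, hT] using hP)
    (fun P _ => by simp) (fun P _ => by simp)
  have hdisj : Disjoint S T := by
    rw [Finset.disjoint_left]
    intro P hP hP'
    exact (Finset.mem_filter.1 hP).2.not_inv hs (Finset.mem_filter.1 hP').2
  have hle := Finset.card_le_mul_card_image_of_maps_to (s := S ∪ T)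
    (t := Finset.univ.erase (0 : F)) (f := Prod.fst) (fun P hP => by
      rcases Finset.mem_union.1 hP with h | h
      · simpa using (Finset.mem_filter.1 h).2.s_ne_zero
      · simpa using (Finset.mem_filter.1 h).2.s_ne_zero) 2 fun s hs' => by
        have hs0 : s ≠ 0 := Finset.ne_of_mem_erase hs'
        refine (Finset.card_le_card_of_injOn Prod.snd (fun P hP => ?_) ?_).trans
          (card_quadratic_roots_le (a := σ (σ κ) + κ * s) (b := σ κ * (s ^ 2 + 1) - v * s)
            (c := s * (κ + σ (σ κ) * s)) fun h =>
              coeffs_not_all_zero h2 hs hκ hne hs0 h.1 h.2.1 h.2.2)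
        · obtain ⟨hPm, rfl⟩ := Finset.mem_filter.1 (Finset.mem_coe.1 hP)
          simp only [Finset.coe_filter, Finset.mem_univ, true_and, Set.mem_ofPred_eq]
          rcases Finset.mem_union.1 hPm with h | h
          · exact (Finset.mem_filter.1 h).2.curve
          · have h := (Finset.mem_filter.1 h).2
            simpa using curve_inv h.s_ne_zero h.w_ne_zero h.curve
        · intro P hP Q hQ h
          exact Prod.ext ((Finset.mem_filter.1 hP).2.trans (Finset.mem_filter.1 hQ).2.symm) h
  rw [Finset.card_union_of_disjoint hdisj, ← hST, Finset.card_erase_of_mem (Finset.mem_univ _),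
    Finset.card_univ] at hle
  omega

end CollinearTripleCount

section IsotropicVector

open Polynomial Finset

variable {F : Type*} [Field F] {σ : F →+* F} {κ v : F} {q : ℕ}

theorem eval_zero_residualFst {a b c : F[X]} (ha : a.eval 0 ≠ 0) (hb : b.eval 0 ≠ 0)
    (hc : c.eval 0 = 0) (κ₀ κ₁ κ₂ : F) (hq : 0 < q) :
    (residualFst a b c κ₀ κ₁ κ₂ q).eval 0 ≠ 0 := by
  have : (residualFst a b c κ₀ κ₁ κ₂ q).eval 0 = -(a.eval 0 ^ q * b.eval 0 ^ q) := by
    simp [residualFst, eval_zero_reducedPow hc, hq.ne']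
  rw [this]
  exact neg_ne_zero.2 (mul_ne_zero (pow_ne_zero q ha) (pow_ne_zero q hb))

theorem residual_resultant_ne_zero [Fintype F] (hF : Fintype.card F = q ^ 3)
    (hσ : ∀ x, σ x = x ^ q) (hq : 1 < q) (h2 : (2 : F) ≠ 0) (hκ : κ ≠ 0)
    (hne : ¬(σ κ = κ ∧ v = -2 * κ))
    (hG : ∀ c, c ≠ 0 → cubicForm κ (σ κ) (σ (σ κ)) v c (σ c) (σ (σ c)) ≠ 0) {B : F[X]} :
    leadPoly κ (σ (σ κ)) * residualFst (leadPoly κ (σ (σ κ))) (midPoly (σ κ) v)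
        (constPoly κ (σ (σ κ))) κ (σ κ) (σ (σ κ)) q ^ 2 -
      midPoly (σ κ) v * residualFst (leadPoly κ (σ (σ κ))) (midPoly (σ κ) v)
        (constPoly κ (σ (σ κ))) κ (σ κ) (σ (σ κ)) q * B +
      constPoly κ (σ (σ κ)) * B ^ 2 ≠ 0 := by
  intro h
  have hs := frobenius_iterate_three hF hσ
  have hκ₁ : σ κ ≠ 0 := (map_ne_zero σ).2 hκ
  have ha : (leadPoly κ (σ (σ κ))).eval 0 ≠ 0 := by simpa [leadPoly] using hκ
  have hA := eval_zero_residualFst (q := q) ha (b := midPoly (σ κ) v)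
    (c := constPoly κ (σ (σ κ))) (by simpa [midPoly] using hκ) (by simp [constPoly])
    κ (σ κ) (σ (σ κ)) (by omega)
  obtain ⟨E, hE⟩ := exists_sq_eq_discrim (by rintro h; simp [h] at ha)
    (by rintro h; simp [h] at hA) h
  rcases degenerate_of_discrim_eq_sq h2 hκ₁ hE with h0 | ⟨h0, h1⟩
  · obtain ⟨u, d, hu, -, hud⟩ := exists_independent_of_trace_eq_zero hF hσ hq one_ne_zero
    simp only [map_one, one_mul] at hu
    have hu0 : u ≠ 0 := by rintro rfl; simp at hud
    refine hG (σ κ * u) (mul_ne_zero hκ₁ hu0) ?_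
    simp only [map_mul, hs]
    unfold cubicForm
    linear_combination (κ ^ 2 * σ κ ^ 2 * (u * σ (σ u)) +
      κ ^ 2 * σ (σ κ) ^ 2 * (σ u * σ (σ u)) + σ κ ^ 2 * σ (σ κ) ^ 2 * (u * σ u)) * hu -
        u * σ u * σ (σ u) * h0
  · have hsq : σ κ ^ 2 = κ ^ 2 := by
      rcases mul_eq_zero.1 h1 with h | h
      · linear_combination h
      · have := congrArg (fun x => σ (σ x)) h
        simp only [map_sub, map_pow, hs, map_zero] at this
        linear_combination -this
    rcases sq_eq_sq_iff_eq_or_eq_neg.1 hsq with h | h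
    · refine hne ⟨h, mul_right_cancel₀ hκ ?_⟩
      rw [h, h] at h0
      linear_combination h0
    · have h3 := hs κ
      rw [h, map_neg, h, neg_neg, h] at h3
      exact mul_ne_zero h2 hκ (by linear_combination -h3)

open Classical in
theorem card_collinearTriples_le_of_anisotropic [Fintype F] (hF : Fintype.card F = q ^ 3)
    (hσ : ∀ x, σ x = x ^ q) (hq : 1 < q) (h2 : (2 : F) ≠ 0) (hκ : κ ≠ 0)
    (hne : ¬(σ κ = κ ∧ v = -2 * κ))
    (hG : ∀ c, c ≠ 0 → cubicForm κ (σ κ) (σ (σ κ)) v c (σ c) (σ (σ c)) ≠ 0) :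
    #{P : F × F | IsCollinearTriple σ κ v P.1 P.2} ≤ 2 * q ^ 2 + 6 * q + 6 := by
  have hs := frobenius_iterate_three hF hσ
  have hq0 : 0 < q := by omega
  set a := leadPoly κ (σ (σ κ)) with ha
  set b := midPoly (σ κ) v with hb
  set c := constPoly κ (σ (σ κ)) with hc
  have eva (s : F) : a.eval s = σ (σ κ) + κ * s := by simp [ha, leadPoly]
  have evb (s : F) : b.eval s = σ κ * (s ^ 2 + 1) - v * s := by simp [hb, midPoly]
  have evc (s : F) : c.eval s = s * (κ + σ (σ κ) * s) := by simp [hc, constPoly]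
  have da : a.natDegree ≤ 1 := by rw [ha, leadPoly]; compute_degree
  have db : b.natDegree ≤ 2 := by rw [hb, midPoly]; compute_degree
  have dc : c.natDegree ≤ 2 := by
    rw [hc, constPoly, mul_add, ← mul_assoc, mul_comm X (C _), mul_assoc]; compute_degree
  set S : Finset (F × F) := {P | IsCollinearTriple σ κ v P.1 P.2} with hS
  have hmem {P : F × F} (hP : P ∈ S) : IsCollinearTriple σ κ v P.1 P.2 :=
    (Finset.mem_filter.1 hP).2
  have hres := natDegree_residual_le da db dc κ (σ κ) (σ (σ κ)) hq0
  have h1 := card_le_natDegree_of_quadratic_of_linear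
    (residual_resultant_ne_zero (B := residualSnd a b c κ (σ κ) (σ (σ κ)) q)
      hF hσ hq h2 hκ hne hG) (S.filter fun P => a.eval P.1 ≠ 0)
    (fun P hP => (Finset.mem_filter.1 hP).2)
    (fun P hP => by
      rw [eva, evb, evc]
      exact (hmem (Finset.mem_filter.1 hP).1).curve)
    (fun P hP => (hmem (Finset.mem_filter.1 hP).1).eval_residual hq0 hσ hs)
  rw [← ha, ← hb, ← hc] at h1
  have h3 : #(S.filter fun P => ¬a.eval P.1 ≠ 0) ≤ 1 := by
    refine Finset.card_le_one.2 fun P hP Q hQ => ?_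
    obtain ⟨hP, hPa⟩ := Finset.mem_filter.1 hP
    obtain ⟨hQ, hQa⟩ := Finset.mem_filter.1 hQ
    rw [not_not, eva] at hPa hQa
    obtain ⟨s, w⟩ := P
    obtain ⟨s', w'⟩ := Q
    obtain rfl : s = s' := mul_left_cancel₀ hκ (by linear_combination hPa - hQa)
    have hcP := (hmem hP).curve
    have hcQ := (hmem hQ).curve
    have hb0 : σ κ * (s ^ 2 + 1) - v * s ≠ 0 := fun hb0 =>
      coeffs_not_all_zero h2 hs hκ hne (hmem hP).s_ne_zero hPa hb0 (by
        linear_combination hcP - w ^ 2 * hPa - w * hb0)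
    have : w = w' := mul_left_cancel₀ hb0 (by
      linear_combination hcP - hcQ - (w ^ 2 - w' ^ 2) * hPa)
    rw [this]
  have h4 := Finset.card_filter_add_card_filter_not (s := S) (fun P => a.eval P.1 ≠ 0)
  have h5 : (a * residualFst a b c κ (σ κ) (σ (σ κ)) q ^ 2 -
      b * residualFst a b c κ (σ κ) (σ (σ κ)) q * residualSnd a b c κ (σ κ) (σ (σ κ)) q +
      c * residualSnd a b c κ (σ κ) (σ (σ κ)) q ^ 2).natDegree ≤ 2 * q ^ 2 + 6 * q + 5 := by
    obtain ⟨hA, hB⟩ := hres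
    refine (natDegree_add_le_of_le (natDegree_sub_le_of_le
      (natDegree_mul_le_of_le da (natDegree_pow_le_of_le 2 hA))
      (natDegree_mul_le_of_le (natDegree_mul_le_of_le db hA) hB))
      (natDegree_mul_le_of_le dc (natDegree_pow_le_of_le 2 hB))).trans ?_
    generalize q ^ 2 = Q
    omega
  omega

theorem exists_cubicForm_eq_zero [Fintype F] (hF : Fintype.card F = q ^ 3)
    (hσ : ∀ x, σ x = x ^ q) (hq : 1 < q) (hodd : Odd q) (h2 : (2 : F) ≠ 0) (hκ : κ ≠ 0)
    (hv : σ v = v) (hne : ¬(σ κ = κ ∧ v = -2 * κ)) :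
    ∃ c, c ≠ 0 ∧ cubicForm κ (σ κ) (σ (σ κ)) v c (σ c) (σ (σ c)) = 0 := by
  classical
  by_contra! hG
  have hlow := le_card_collinearTriples hF hσ hq hκ hv hG
  have hq3 : 3 ≤ q := by obtain ⟨k, rfl⟩ := hodd; omega
  rcases hq3.eq_or_lt with rfl | hq3
  · have hup := card_collinearTriples_le h2 (frobenius_iterate_three hF hσ) hκ hne
    rw [hF] at hup
    omega
  · have hup := card_collinearTriples_le_of_anisotropic hF hσ hq h2 hκ hne hG
    have hq5 : 5 ≤ q := by obtain ⟨k, rfl⟩ := hodd; omega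
    nlinarith

end IsotropicVector

section Planarity

open Polynomial Finset

variable {F : Type*} [Field F] {σ : F →+* F} {q : ℕ}

theorem mul_eq_of_map_eq_self [Fintype F] (hF : Fintype.card F = q ^ 3) (hσ : ∀ x, σ x = x ^ q)
    (hq : 1 < q) (hodd : Odd q) (h2 : (2 : F) ≠ 0) {a : F} (ha : a ≠ 0) {L : F → F}
    (hL : ∀ x c, x ≠ 0 → c ≠ 0 → a * (σ x * c + σ c * x) + σ (a * (σ x * c + σ c * x)) +
      σ (σ (a * (σ x * c + σ c * x))) + 2 * L (x * c) ≠ 0)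
    {u : F} (hu : u ≠ 0) (hLu : σ (L u) = L u) : L u * σ a = a * σ (σ a) * u := by
  have hs := frobenius_iterate_three hF hσ
  obtain ⟨k, hk⟩ := hodd
  have hu₁ : σ u ≠ 0 := (map_ne_zero σ).2 hu
  have hu₂ : σ (σ u) ≠ 0 := (map_ne_zero σ).2 hu₁
  obtain ⟨μ, hμ, hμu⟩ : ∃ μ, μ ≠ 0 ∧ μ ^ 2 = u * (u * σ u * σ (σ u)) := by
    refine ⟨u * σ u ^ (k + 1), mul_ne_zero hu (pow_ne_zero _ hu₁), ?_⟩
    rw [hσ (σ u), mul_pow, ← pow_mul, show (k + 1) * 2 = q + 1 by omega, pow_succ]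
    ring
  obtain ⟨y, hy, hyσ, huy⟩ : ∃ y, y ≠ 0 ∧ σ y = y ∧ u = μ ^ 2 * y := by
    refine ⟨(u * σ u * σ (σ u))⁻¹, by positivity, ?_, ?_⟩
    · simp only [map_inv₀, map_mul, hs]
      ring
    · rw [hμu]; field_simp
  have hμ₁ : σ μ ≠ 0 := (map_ne_zero σ).2 hμ
  have hμ₂ : σ (σ μ) ≠ 0 := (map_ne_zero σ).2 hμ₁
  set κ := a * (μ * σ μ) * y with hκ
  have hκ0 : κ ≠ 0 := mul_ne_zero (mul_ne_zero ha (mul_ne_zero hμ hμ₁)) hy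
  by_cases hsp : σ κ = κ ∧ -2 * L u = -2 * κ
  · obtain ⟨h1, h3⟩ := hsp
    have hLκ : L u = κ := mul_left_cancel₀ (neg_ne_zero.2 h2) h3
    have e1 : κ = σ a * (σ μ * σ (σ μ)) * y := by
      rw [← h1, hκ]; simp only [map_mul, hyσ]
    have e2 : κ = σ (σ a) * (σ (σ μ) * μ) * y := by
      rw [← h1, ← h1, hκ]; simp only [map_mul, hyσ, hs]
    refine mul_right_cancel₀ (mul_ne_zero (mul_ne_zero hμ₁ hμ₂) hy) ?_
    rw [hLκ]
    linear_combination -κ * e1 + κ * hκ + a * (μ * σ μ) * y * e2 -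
      a * σ (σ a) * (σ μ * σ (σ μ) * y) * huy
  · obtain ⟨c, hc, hcub⟩ := exists_cubicForm_eq_zero hF hσ hq ⟨k, hk⟩ h2 hκ0
      (by simp [hLu, map_ofNat]) hsp
    have hc₁ : σ c ≠ 0 := (map_ne_zero σ).2 hc
    have hc₂ : σ (σ c) ≠ 0 := (map_ne_zero σ).2 hc₁
    have e : a * (σ (u / (μ * c)) * (μ * c) + σ (μ * c) * (u / (μ * c))) =
        κ * (c / σ c + σ c / c) := by
      rw [huy, hκ]
      simp only [map_div₀, map_mul, map_pow, hyσ]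
      field_simp
    refine absurd ?_ (hL (u / (μ * c)) (μ * c) (div_ne_zero hu (mul_ne_zero hμ hc))
      (mul_ne_zero hμ hc))
    rw [e, div_mul_cancel₀ u (mul_ne_zero hμ hc)]
    simp only [map_mul, map_add, map_div₀, hs]
    unfold cubicForm at hcub
    field_simp
    linear_combination hcub

theorem polar_ne_zero_iff [Fintype F] (hF : Fintype.card F = q ^ 3) (hσ : ∀ x, σ x = x ^ q)
    (hq : 1 < q) (hodd : Odd q) (h2 : (2 : F) ≠ 0) {a : F} (ha : a ≠ 0) (L : F →+ F) :
    (∀ x c, x ≠ 0 → c ≠ 0 → a * (σ x * c + σ c * x) + σ (a * (σ x * c + σ c * x)) +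
      σ (σ (a * (σ x * c + σ c * x))) + 2 * L (x * c) ≠ 0) ↔
    Function.Bijective L ∧ ∀ y, σ y = y → L (σ a ^ 2 * y) = a * σ a * σ (σ a) * y := by
  have hs := frobenius_iterate_three hF hσ
  have ha₁ : σ a ≠ 0 := (map_ne_zero σ).2 ha
  have ha₂ : σ (σ a) ≠ 0 := (map_ne_zero σ).2 ha₁
  have hNa : a * σ a * σ (σ a) ≠ 0 := mul_ne_zero (mul_ne_zero ha ha₁) ha₂
  have hNσ : σ (a * σ a * σ (σ a)) = a * σ a * σ (σ a) := by
    simp only [map_mul, hs]; ring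
  constructor
  · intro hL
    have hinj : Function.Injective L := by
      rw [injective_iff_map_eq_zero]
      intro u hLu
      by_contra hu
      have h := mul_eq_of_map_eq_self hF hσ hq hodd h2 ha hL hu (by rw [hLu, map_zero])
      rw [hLu, zero_mul] at h
      exact mul_ne_zero (mul_ne_zero ha ha₂) hu h.symm
    have hbij := Finite.injective_iff_bijective.1 hinj
    refine ⟨hbij, fun y hy => ?_⟩
    rcases eq_or_ne y 0 with rfl | hy0
    · simp
    obtain ⟨u, hu⟩ := hbij.2 (a * σ a * σ (σ a) * y)
    have hu0 : u ≠ 0 := by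
      rintro rfl
      exact mul_ne_zero hNa hy0 (by rw [← hu, map_zero])
    have h := mul_eq_of_map_eq_self hF hσ hq hodd h2 ha hL hu0 (by
      rw [hu, map_mul, hNσ, hy])
    rw [hu] at h
    rw [← hu]
    congr 1
    exact mul_left_cancel₀ (mul_ne_zero ha ha₂) (by linear_combination h)
  · rintro ⟨hbij, hy⟩ x c hx hc h
    set t := a * (σ x * c + σ c * x) with ht
    have hLσ : σ (L (x * c)) = L (x * c) := by
      have h' := congrArg σ h
      simp only [map_add, map_mul, hs, map_ofNat, map_zero] at h'
      refine mul_left_cancel₀ h2 ?_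
      linear_combination h' - h
    set y := L (x * c) / (a * σ a * σ (σ a)) with hydef
    have hLy : L (x * c) = a * σ a * σ (σ a) * y := by
      rw [hydef, mul_div_cancel₀ _ hNa]
    have hyσ : σ y = y := by rw [hydef, map_div₀, hLσ, hNσ]
    have hxc : x * c = σ a ^ 2 * y := hbij.1 (by rw [hLy, hy y hyσ])
    have hy0 : y ≠ 0 := by
      intro hy0
      rw [hy0, mul_zero] at hxc
      exact mul_ne_zero hx hc hxc
    have hc₁ : σ c ≠ 0 := (map_ne_zero σ).2 hc
    have hc₂ : σ (σ c) ≠ 0 := (map_ne_zero σ).2 hc₁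
    have hxc₁ := congrArg σ hxc
    have hxc₂ := congrArg σ hxc₁
    simp only [map_mul, map_pow, hs, hyσ] at hxc₁ hxc₂
    rw [hLy, ht] at h
    simp only [map_mul, map_add, hs] at h
    have hprod : y * ((c * σ (σ a) + σ c * σ a) * σ (c * σ (σ a) + σ c * σ a) *
        σ (σ (c * σ (σ a) + σ c * σ a))) = 0 := by
      simp only [map_mul, map_add, hs]
      linear_combination c * σ c * σ (σ c) * h -
        (a * σ c ^ 2 * σ (σ c) + σ (σ a) * σ (σ c) ^ 2 * σ c) * hxc -
        (a * c ^ 2 * σ (σ c) + σ a * σ (σ c) ^ 2 * c) * hxc₁ -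
        (σ a * σ c ^ 2 * c + σ (σ a) * c ^ 2 * σ c) * hxc₂
    have h0 : c * σ (σ a) + σ c * σ a = 0 := by
      by_contra h0
      have h0₁ := (map_ne_zero σ).2 h0
      exact mul_ne_zero hy0 (mul_ne_zero (mul_ne_zero h0 h0₁) ((map_ne_zero σ).2 h0₁)) hprod
    have h0₁ := congrArg σ h0
    have h0₂ := congrArg σ h0₁
    simp only [map_mul, map_add, hs, map_zero] at h0₁ h0₂
    refine mul_ne_zero (mul_ne_zero h2 hNa) (mul_ne_zero (mul_ne_zero hc hc₁) hc₂) ?_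
    linear_combination σ c * a * (σ (σ c) * σ a) * h0 - σ c * σ a * (σ (σ c) * σ a) * h0₁ +
      σ c * σ a * (σ (σ c) * σ (σ a)) * h0₂

theorem sum_mul_pow_eq_iff [Fintype F] {p m : ℕ} (hp : 1 < p) (hq : q = p ^ m) (hm : 0 < m)
    (hF : Fintype.card F = q ^ 3) (d : Fin m → F) (n : F) :
    (∀ y : F, y ^ q = y → ∑ i, d i * y ^ p ^ (i : ℕ) = n * y) ↔
      ∀ i : Fin m, d i = if (i : ℕ) = 0 then n else 0 := by
  classical
  have hsum (y : F) : ∑ i : Fin m, (if (i : ℕ) = 0 then n else 0) * y ^ p ^ (i : ℕ) = n * y := by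
    rw [Finset.sum_eq_single_of_mem ⟨0, hm⟩ (Finset.mem_univ _)]
    · simp
    · intro i _ hi
      rw [if_neg fun h => hi (Fin.ext h), zero_mul]
  constructor
  · intro h
    set P : F[X] := ∑ i : Fin m, C (d i - if (i : ℕ) = 0 then n else 0) * X ^ p ^ (i : ℕ) with hP
    have hdeg : P.natDegree < q := by
      refine lt_of_le_of_lt (natDegree_sum_le_of_forall_le _ _ (n := p ^ (m - 1)) fun i _ =>
        (natDegree_C_mul_X_pow_le _ _).trans (Nat.pow_le_pow_right (by omega) (by omega))) ?_
      rw [hq]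
      exact Nat.pow_lt_pow_right hp (by omega)
    have hP0 : P = 0 := eq_zero_of_natDegree_lt_card_of_eval_eq_zero' P
      ({x : F | x ^ q = x} : Finset F) (fun y hy => by
        have hy' := h y (by simpa using hy)
        simp only [hP, eval_finsetSum, eval_mul, eval_C, eval_pow, eval_X, sub_mul,
          Finset.sum_sub_distrib, hsum, hy', sub_self])
      (hdeg.trans_le (le_card_filter_pow_eq_self hF (by
        rw [hq]; exact Nat.one_lt_pow hm.ne' hp)))
    intro i
    have hi := congrArg (coeff · (p ^ (i : ℕ))) hP0
    simp only [hP, finsetSum_coeff, coeff_C_mul, coeff_X_pow, coeff_zero,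
      (Nat.pow_right_injective hp).eq_iff, Fin.val_inj, mul_ite, mul_one, mul_zero,
      Finset.sum_ite_eq, Finset.mem_univ, if_true] at hi
    exact sub_eq_zero.1 hi
  · intro h y _
    simp only [h, hsum]

end Planarity

/-- on `F_{q³}`, the function `Tr(a·x^{q+1}) + ℓ(x²)` with
`ℓ(x) = Σ_{i<m} Σ_{j<3} b_{ij}·x^{p^i q^j}` is planar iff `ℓ` is a bijection and
`Σ_j b_{ij}·a^{2p^i q^{j+1}}` equals `N(a)` for `i = 0` and `0` otherwise. -/
theorem planar_on_cubic_extension_iff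
    (p m : ℕ) (hp : p.Prime) (hodd : Odd p) (hm : 0 < m)
    (q : ℕ) (hq : q = p ^ m)
    (F : Type*) [Field F] [Fintype F] (hF : Fintype.card F = q ^ 3)
    (a : F) (ha : a ≠ 0)
    (b : Fin m → Fin 3 → F)
    (ℓ : F → F)
    (hℓ : ∀ x, ℓ x = ∑ i : Fin m, ∑ j : Fin 3, b i j * x ^ (p ^ (i : ℕ) * q ^ (j : ℕ)))
    (Tr : F → F) (hTr : ∀ x, Tr x = x + x ^ q + x ^ q ^ 2)
    (f : F → F) (hf : ∀ x, f x = Tr (a * x ^ (q + 1)) + ℓ (x ^ 2)) :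
    (∀ c : F, c ≠ 0 → Function.Bijective (fun x => f (x + c) - f x)) ↔
      (Function.Bijective ℓ ∧
        ∀ i : Fin m,
          (∑ j : Fin 3, b i j * a ^ (2 * p ^ (i : ℕ) * q ^ ((j : ℕ) + 1))) =
            if (i : ℕ) = 0 then a ^ (1 + q + q ^ 2) else 0) := by
  have : Fact p.Prime := ⟨hp⟩
  have : CharP F p := charP_of_card_eq_prime_pow (f := m * 3) (by rw [hF, hq, pow_mul])
  have h2 : (2 : F) ≠ 0 := Ring.two_ne_zero (by
    rw [ringChar.eq F p]
    rintro rfl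
    exact absurd hodd (by decide))
  have hq1 : 1 < q := by rw [hq]; exact Nat.one_lt_pow hm.ne' hp.one_lt
  set σ : F →+* F := iterateFrobenius F p m
  have hσ (x : F) : σ x = x ^ q := by rw [hq]; exact iterateFrobenius_def p m x
  have hσσ (x : F) : σ (σ x) = x ^ q ^ 2 := by rw [hσ, hσ, ← pow_mul, sq]
  have hs := frobenius_iterate_three hF hσ
  let L : F →+ F := AddMonoidHom.mk' ℓ fun x y => by
    simp only [hℓ, ← Finset.sum_add_distrib, ← mul_add]
    refine Finset.sum_congr rfl fun i _ => Finset.sum_congr rfl fun j _ => ?_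
    rw [hq, ← pow_mul, ← pow_add, add_pow_char_pow]
  have hLℓ (x : F) : ℓ x = L x := rfl
  have hTr' (x : F) : Tr x = x + σ x + σ (σ x) := by rw [hTr, hσσ, hσ]
  have hpolar (x c : F) : f (x + c) - f x = f c + (a * (σ x * c + σ c * x) +
      σ (a * (σ x * c + σ c * x)) + σ (σ (a * (σ x * c + σ c * x))) + 2 * L (x * c)) := by
    have hsq : L ((x + c) ^ 2) = L (x ^ 2) + L (c ^ 2) + 2 * L (x * c) := by
      rw [show (x + c) ^ 2 = x ^ 2 + c ^ 2 + (x * c + x * c) by ring]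
      simp only [map_add]
      ring
    simp only [hf, hTr', pow_succ _ q, ← hσ, hLℓ, hsq, map_add, map_mul]
    ring
  have hplanar : (∀ c : F, c ≠ 0 → Function.Bijective (fun x => f (x + c) - f x)) ↔
      ∀ x c, x ≠ 0 → c ≠ 0 → a * (σ x * c + σ c * x) + σ (a * (σ x * c + σ c * x)) +
        σ (σ (a * (σ x * c + σ c * x))) + 2 * L (x * c) ≠ 0 := by
    constructor
    · intro h x c hx hc h0
      refine hx ((h c hc).1 ?_)
      simp only [hpolar, h0, zero_mul, mul_zero, map_zero, add_zero]
    · intro h c hc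
      refine Finite.injective_iff_bijective.1 fun x y hxy => ?_
      simp only [hpolar] at hxy
      by_contra hne
      refine h (x - y) c (sub_ne_zero.2 hne) hc ?_
      rw [sub_mul x y c, map_sub L]
      simp only [map_sub, map_add, map_mul] at hxy ⊢
      linear_combination hxy
  have hcond (y : F) (hy : σ y = y) : L (σ a ^ 2 * y) =
      ∑ i : Fin m, (∑ j : Fin 3, b i j * a ^ (2 * p ^ (i : ℕ) * q ^ ((j : ℕ) + 1))) *
        y ^ p ^ (i : ℕ) := by
    rw [← hLℓ, hℓ]
    refine Finset.sum_congr rfl fun i _ => ?_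
    rw [Finset.sum_mul]
    refine Finset.sum_congr rfl fun j _ => ?_
    have hyj : ∀ n : ℕ, y ^ q ^ n = y := fun n => by
      induction n with
      | zero => simp
      | succ n ih => rw [pow_succ, pow_mul, ih, ← hσ, hy]
    rw [mul_pow, mul_comm (p ^ (i : ℕ)), pow_mul y, hyj, hσ, ← pow_mul, ← pow_mul, ← mul_assoc]
    congr 3
    ring
  have hN : a ^ (1 + q + q ^ 2) = a * σ a * σ (σ a) := by rw [hσσ, hσ]; ring
  have hcoeff := sum_mul_pow_eq_iff hp.one_lt hq hm hF
    (fun i : Fin m => ∑ j : Fin 3, b i j * a ^ (2 * p ^ (i : ℕ) * q ^ ((j : ℕ) + 1)))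
    (a ^ (1 + q + q ^ 2))
  rw [hplanar, polar_ne_zero_iff hF hσ hq1 (hq ▸ hodd.pow) h2 ha L, ← hcoeff]
  refine and_congr Iff.rfl (forall_congr' fun y => ?_)
  rw [← hσ y]
  refine forall_congr' fun hy => ?_
  rw [hcond y hy, hN]
end

section
/- Let q be a power of an odd prime, A, B ∈ F_{q³}*, and r ∈ F_q. Then the function x ↦ Tr(A·x^{q−1} + B·x^{1−q}) + r has no root in F_{q³}* if and only if r ≠ 0 and A·B·r = N(A) + N(B). -/
open Polynomial in
theorem natDegree_le_card_mul_of_dvd_prod_map {K ι : Type*} [Field K] (n : ℕ) (f : ι → K[X])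
    (t : Multiset ι) (s : K[X]) (hs : s ∣ (t.map f).prod)
    (hf : ∀ i ∈ t, ∀ d : K[X], d ∣ s → d ∣ f i → d.natDegree ≤ n) :
    s.natDegree ≤ n * t.card := by
  induction t using Multiset.induction_on generalizing s with
  | empty => simpa using natDegree_le_of_dvd (by simpa using hs) one_ne_zero
  | cons a t ih =>
    rw [Multiset.map_cons, Multiset.prod_cons] at hs
    obtain ⟨d, e, hd, he, rfl⟩ := exists_dvd_and_dvd_of_dvd_mul hs
    have h1 := hf a (Multiset.mem_cons_self a t) d (dvd_mul_right d e) hd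
    have h2 := ih e he fun i hi c hc ↦
      hf i (Multiset.mem_cons_of_mem hi) c (hc.trans (dvd_mul_left e d))
    calc (d * e).natDegree ≤ d.natDegree + e.natDegree := natDegree_mul_le
      _ ≤ n + n * t.card := add_le_add h1 h2
      _ = n * (a ::ₘ t).card := by rw [Multiset.card_cons]; ring

open Polynomial in
theorem FiniteField.splits_X_pow_fintypeCard_sub_X (K : Type*) [Field K] [Fintype K] :
    (X ^ Fintype.card K - X : K[X]).Splits := by
  rw [splits_iff_card_roots, FiniteField.roots_X_pow_card_sub_X,
    FiniteField.X_pow_card_sub_X_natDegree_eq K Fintype.one_lt_card]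
  simp

section Frobenius

variable {K : Type*} [Field K] [Fintype K] {p m q : ℕ} [ExpChar K p]

theorem pow_pow_pow_of_card (hK : Fintype.card K = q ^ 3) (a : K) : ((a ^ q) ^ q) ^ q = a := by
  rw [← pow_mul, ← pow_mul, ← mul_assoc, show q * q * q = q ^ 3 by ring, ← hK, FiniteField.pow_card]

open Polynomial in
/-- The cubic `N(x) = Tr(μ x) - κ` has a solution on the plane `Tr(x) = -r` unless
`μ ∈ F_q` and `κ = -μ r`. In the proof, solutions are the common roots of `s` and `T`. Since
`s ^ q - s = T * (W ^ q - W)`, the absence of a common root forces `s ∣ W ^ q - W`, but each of the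
`q` factors `W - a` shares at most a quadratic factor with `s`, which has degree `2 * q + 1`. -/
theorem exists_trace_eq_and_norm_eq (hq : q = p ^ m) (hq1 : 1 < q)
    (hK : Fintype.card K = q ^ 3) (μ r κ : K) (hr : r ^ q = r) (hκ : κ ^ q = κ)
    (hdeg : ¬(μ ^ q = μ ∧ κ = -(μ * r))) :
    ∃ x : K, x + x ^ q + (x ^ q) ^ q + r = 0 ∧
      x * x ^ q * (x ^ q) ^ q = μ * x + μ ^ q * x ^ q + (μ ^ q) ^ q * (x ^ q) ^ q - κ := by
  obtain ⟨φ, hφ⟩ : ∃ φ : K[X] →+* K[X], ∀ f, φ f = f ^ q :=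
    ⟨iterateFrobenius K[X] p m, fun f ↦ by rw [iterateFrobenius_def, hq]⟩
  have hμ3 := pow_pow_pow_of_card hK μ
  obtain ⟨μ₁, hμ₁⟩ : ∃ a, a = μ ^ q := ⟨_, rfl⟩
  obtain ⟨μ₂, hμ₂⟩ : ∃ a, a = μ₁ ^ q := ⟨_, rfl⟩
  rw [← hμ₁, ← hμ₂] at hμ3
  rw [← hμ₁] at hdeg ⊢
  rw [← hμ₂]
  by_contra! hno
  classical
  let Y : K[X] := X ^ q
  let Z : K[X] := Y ^ q
  have hφC (a : K) : φ (C a) = C (a ^ q) := by rw [hφ, C_pow]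
  have hφX : φ X = Y := hφ X
  have hφY : φ Y = Z := hφ Y
  let s : K[X] := X * Y * (C r + X + Y) + C μ * X + C μ₁ * Y - C μ₂ * (C r + X + Y) - C κ
  let T : K[X] := C r + X + Y + Z
  let W : K[X] := X * Y - C μ₂
  have hid : s ^ q - s = T * (W ^ q - W) := by
    rw [← hφ, ← hφ]
    simp only [s, W, T, map_add, map_sub, map_mul, hφC, hφX, hφY, hr, hκ, hμ3, ← hμ₁, ← hμ₂]
    ring
  have hTq : T ∣ X ^ Fintype.card K - X := by
    have h : (X ^ Fintype.card K - X : K[X]) = φ T - T := by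
      have hZ : φ Z = X ^ Fintype.card K := by
        rw [hφ, hK]; simp only [Z, Y]; ring
      simp only [T, map_add, hφC, hφX, hφY, hr, hZ]
      ring
    rw [h, hφ]
    exact dvd_sub_self_right.mpr (dvd_pow_self T (by omega))
  have hcop : IsCoprime s T := by
    rw [← EuclideanDomain.gcd_isUnit_iff]
    by_contra hu
    have hne : (X ^ Fintype.card K - X : K[X]) ≠ 0 :=
      FiniteField.X_pow_card_sub_X_ne_zero K Fintype.one_lt_card
    have hd := EuclideanDomain.gcd_dvd_right s T
    have hg0 : EuclideanDomain.gcd s T ≠ 0 := ne_zero_of_dvd_ne_zero hne (hd.trans hTq)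
    obtain ⟨x, hx⟩ := Splits.exists_eval_eq_zero
      ((FiniteField.splits_X_pow_fintypeCard_sub_X K).of_dvd hne (hd.trans hTq))
      (fun h ↦ hu (isUnit_iff_degree_eq_zero.mpr h))
    have hsx := eval_eq_zero_of_dvd_of_eval_eq_zero (EuclideanDomain.gcd_dvd_left s T) hx
    have hTx := eval_eq_zero_of_dvd_of_eval_eq_zero hd hx
    simp only [s, T, Y, Z, eval_add, eval_sub, eval_mul, eval_pow, eval_C, eval_X] at hsx hTx
    refine hno x (by linear_combination hTx) ?_
    linear_combination -hsx + (x * x ^ q - μ₂) * hTx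
  have hsD : s ∣ W ^ q - W := by
    refine hcop.dvd_of_dvd_mul_left (hid ▸ ?_)
    exact dvd_sub_self_right.mpr (dvd_pow_self s (by omega))
  have hne : (X ^ q - X : K[X]) ≠ 0 := FiniteField.X_pow_card_sub_X_ne_zero K hq1
  have hspl : (X ^ q - X : K[X]).Splits := by
    refine (FiniteField.splits_X_pow_fintypeCard_sub_X K).of_dvd
      (FiniteField.X_pow_card_sub_X_ne_zero K Fintype.one_lt_card) ?_
    have h : (X ^ Fintype.card K - X : K[X]) =
        φ (φ (X ^ q - X)) + φ (X ^ q - X) + (X ^ q - X) := by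
      simp only [map_sub, map_pow, hφX, hφY, hK]
      simp only [Y, Z]
      ring
    rw [h, hφ, hφ]
    exact dvd_add (dvd_add ((dvd_pow_self _ (by omega)).trans (dvd_pow_self _ (by omega)))
      (dvd_pow_self _ (by omega))) dvd_rfl
  have hmonic : (X ^ q - X : K[X]).Monic := monic_X_pow_sub (by rw [degree_X]; exact_mod_cast hq1)
  have hcard : (X ^ q - X : K[X]).roots.card = q := by
    rw [← hspl.natDegree_eq_card_roots, FiniteField.X_pow_card_sub_X_natDegree_eq K hq1]
  have hprod : W ^ q - W = ((X ^ q - X : K[X]).roots.map fun a ↦ W - C a).prod := by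
    have h := congrArg (fun f : K[X] ↦ f.comp W) (hspl.eq_prod_roots_of_monic hmonic)
    simpa [multiset_prod_comp, Multiset.map_map, Function.comp_def] using h
  have hle : s.natDegree ≤ 2 * q := by
    rw [← hcard]
    refine natDegree_le_card_mul_of_dvd_prod_map 2 _ _ s (hprod ▸ hsD) fun a ha d hds hda ↦ ?_
    have haq : a ^ q = a := by
      simpa [sub_eq_zero] using (mem_roots hne).mp ha
    let Q : K[X] := C (a + μ) * X ^ 2 + C (a * r - κ) * X + C ((a + μ₁) * (a + μ₂))
    have hQ : X * s - (W - C a) * (X * (C r + X + Y) + C (a + μ₁)) = Q := by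
      simp only [s, W, Q, map_add, map_sub, map_mul]
      ring
    have hdQ : d ∣ Q := hQ ▸ dvd_sub (hds.mul_left X) (hda.mul_right _)
    refine (natDegree_le_of_dvd hdQ fun h0 ↦ hdeg ?_).trans natDegree_quadratic_le
    have h2 : a + μ = 0 := by simpa [Q, coeff_X, coeff_C, -map_add, -map_mul] using congrArg (coeff · 2) h0
    have h1 : a * r - κ = 0 := by simpa [Q, coeff_X, coeff_C, -map_add, -map_mul] using congrArg (coeff · 1) h0
    have ha' : a = -μ := by linear_combination h2
    refine ⟨?_, by linear_combination r * h2 - h1⟩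
    have h3 : φ (C (a + μ)) = 0 := by rw [h2]; simp
    rw [map_add, map_add, hφC, hφC, haq, ← hμ₁, ← C_add, C_eq_zero] at h3
    linear_combination h3 - h2
  have hge : 2 * q + 1 ≤ s.natDegree := by
    apply le_natDegree_of_ne_zero
    have hs : s = X ^ (2 * q + 1) + X ^ (q + 2) + C r * X ^ (q + 1) + C (μ - μ₂) * X
        + C (μ₁ - μ₂) * X ^ q - C (μ₂ * r + κ) := by
      simp only [s, Y, map_add, map_sub, map_mul]
      ring
    have e1 : 2 * q + 1 ≠ q + 2 := by omega
    have e2 : 2 * q + 1 ≠ q + 1 := by omega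
    have e3 : 1 ≠ 2 * q + 1 := by omega
    have e4 : 2 * q + 1 ≠ q := by omega
    have e5 : 2 * q + 1 ≠ 0 := by omega
    rw [hs]
    simp only [coeff_add, coeff_sub, coeff_C_mul, coeff_X_pow, coeff_X, coeff_C, if_pos,
      if_neg e1, if_neg e2, if_neg e3, if_neg e4, if_neg e5]
    simp
  omega

open Polynomial in
/-- An element `y ≠ 0` in the kernel of a linearized polynomial `α y + β y ^ q + γ y ^ (q ^ 2)`
over the field with `q ^ 3` elements, when its Dickson determinant vanishes. -/
theorem exists_ne_zero_of_dickson_det_eq_zero (hq : q = p ^ m) (hq1 : 1 < q)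
    (hK : Fintype.card K = q ^ 3) (α β γ : K)
    (hdet : α * α ^ q * (α ^ q) ^ q + β * β ^ q * (β ^ q) ^ q + γ * γ ^ q * (γ ^ q) ^ q
      - α * β ^ q * (γ ^ q) ^ q - β * γ ^ q * (α ^ q) ^ q - γ * α ^ q * (β ^ q) ^ q = 0) :
    ∃ y : K, y ≠ 0 ∧ α * y + β * y ^ q + γ * (y ^ q) ^ q = 0 := by
  obtain ⟨φ, hφ⟩ : ∃ φ : K →+* K, ∀ a, φ a = a ^ q :=
    ⟨iterateFrobenius K p m, fun a ↦ by rw [iterateFrobenius_def, hq]⟩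
  have h3 (a : K) : φ (φ (φ a)) = a := by simp only [hφ, pow_pow_pow_of_card hK]
  simp only [← hφ] at hdet ⊢
  let M : Matrix (Fin 3) (Fin 3) K :=
    !![α, β, γ; φ γ, φ α, φ β; φ (φ β), φ (φ γ), φ (φ α)]
  have hM : M.det = 0 := by
    rw [Matrix.det_fin_three]
    simp [M]
    linear_combination hdet
  obtain ⟨v, hv, hMv⟩ := Matrix.exists_mulVec_eq_zero_iff.mpr hM
  have e0 := congrFun hMv 0
  have e1 := congrFun hMv 1
  have e2 := congrFun hMv 2
  simp [M, Matrix.mulVec, dotProduct, Fin.sum_univ_three] at e0 e1 e2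
  have e1' := congrArg (fun a ↦ φ (φ a)) e1
  have e2' := congrArg φ e2
  simp only [map_add, map_mul, map_zero, h3] at e1' e2'
  suffices ∃ t : K, t * v 0 + φ t * φ (v 2) + φ (φ t) * φ (φ (v 1)) ≠ 0 by
    obtain ⟨t, ht⟩ := this
    refine ⟨_, ht, ?_⟩
    simp only [map_add, map_mul, h3]
    linear_combination t * e0 + φ t * e2' + φ (φ t) * e1'
  by_contra! hall
  let f : K[X] := C (v 0) * X + C (φ (v 2)) * X ^ q + C (φ (φ (v 1))) * X ^ (q ^ 2)
  have hqq : q < q ^ 2 := by nlinarith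
  have hf : f = 0 := by
    refine eq_zero_of_natDegree_lt_card_of_eval_eq_zero f Function.injective_id (fun t ↦ ?_) ?_
    · simp only [f, eval_add, eval_mul, eval_C, eval_X, eval_pow, id]
      have h := hall t
      rw [hφ (φ t), hφ t] at h
      linear_combination h
    · have hle : f.natDegree ≤ q ^ 2 := by
        refine natDegree_add_le_of_degree_le (natDegree_add_le_of_degree_le ?_ ?_) ?_
        · exact (natDegree_C_mul_le _ _).trans (by rw [natDegree_X]; omega)
        · exact (natDegree_C_mul_X_pow_le _ _).trans hqq.le
        · exact natDegree_C_mul_X_pow_le _ _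
      rw [hK]
      exact hle.trans_lt (Nat.pow_lt_pow_right hq1 (by norm_num))
  have n1 : 1 ≠ q := by omega
  have n2 : 1 ≠ q ^ 2 := by omega
  have n3 : q ≠ q ^ 2 := by omega
  have c0 := congrArg (coeff · 1) hf
  have c1 := congrArg (coeff · q) hf
  have c2 := congrArg (coeff · (q ^ 2)) hf
  simp only [f, coeff_add, coeff_C_mul, coeff_X_pow, coeff_X, if_neg n1, if_neg n2, if_neg n3,
    if_neg n3.symm, coeff_zero, if_true, mul_one, mul_zero,
    add_zero, zero_add, map_eq_zero] at c0 c1 c2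
  apply hv
  ext i
  fin_cases i
  exacts [c0, c2, c1]

end Frobenius

theorem mul_cubic_eq_prod_linear_sub {K : Type*} [Field K] {a a₁ a₂ b b₁ b₂ x y z : K}
    (hx : x ≠ 0) (hy : y ≠ 0) (hz : z ≠ 0) (h₁ : a₁ * b₁ = a * b) (h₂ : a₂ * b₂ = a * b) :
    a * b * (a * (y / x) + b * (x / y) + a₁ * (z / y) + b₁ * (y / z) + a₂ * (x / z)
      + b₂ * (z / x)) * (x * y * z) =
    (a₂ * y + b * z) * (a * z + b₁ * x) * (a₁ * x + b₂ * y)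
      - (a * a₁ * a₂ + b * b₁ * b₂) * (x * y * z) := by
  field_simp
  linear_combination -(a₂ * x ^ 2 * y + b * x ^ 2 * z) * h₁ - (a * y ^ 2 * z + b₁ * x * y ^ 2) * h₂

/-- for `A, B ∈ F_{q³}*` and `r ∈ F_q`, the function
`x ↦ Tr(A·x^{q−1} + B·x^{1−q}) + r` has no root in `F_{q³}*` iff `r ≠ 0` and
`A·B·r = N(A) + N(B)`. -/
theorem no_root_iff_norm_condition
    (p m : ℕ) (hp : p.Prime) (hodd : Odd p) (hm : 0 < m)
    (q : ℕ) (hq : q = p ^ m)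
    (F : Type*) [Field F] [Fintype F] (hF : Fintype.card F = q ^ 3)
    (A B : F) (hA : A ≠ 0) (hB : B ≠ 0)
    (r : F) (hr : r ^ q = r)
    (Tr : F → F) (hTr : ∀ x, Tr x = x + x ^ q + x ^ q ^ 2) :
    (∀ x : F, x ≠ 0 → Tr (A * x ^ (q - 1) + B * (x ^ (q - 1))⁻¹) + r ≠ 0) ↔
      (r ≠ 0 ∧ A * B * r = A ^ (1 + q + q ^ 2) + B ^ (1 + q + q ^ 2)) := by
  have : Fact p.Prime := ⟨hp⟩
  have : CharP F p := charP_of_card_eq_prime_pow (f := m * 3) (by rw [hF, hq, pow_mul])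
  have : ExpChar F p := ExpChar.prime hp
  have hq1 : 1 < q := hq ▸ Nat.one_lt_pow hm.ne' hp.one_lt
  obtain ⟨φ, hφ⟩ : ∃ φ : F →+* F, ∀ a, φ a = a ^ q :=
    ⟨iterateFrobenius F p m, fun a ↦ by rw [iterateFrobenius_def, hq]⟩
  have h3 (a : F) : φ (φ (φ a)) = a := by simp only [hφ, pow_pow_pow_of_card hF]
  have hN (a : F) : a ^ (1 + q + q ^ 2) = a * φ a * φ (φ a) := by rw [hφ, hφ]; ring
  have hφr : φ r = r := (hφ r).trans hr
  have hval (x : F) (hx : x ≠ 0) : Tr (A * x ^ (q - 1) + B * (x ^ (q - 1))⁻¹) =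
      A * (φ x / x) + B * (x / φ x) + φ A * (φ (φ x) / φ x) + φ B * (φ x / φ (φ x))
        + φ (φ A) * (x / φ (φ x)) + φ (φ B) * (φ (φ x) / x) := by
    have hu : x ^ (q - 1) = φ x / x := by
      rw [hφ, eq_div_iff hx, ← pow_succ, Nat.sub_add_cancel hq1.le]
    have hT (z : F) : Tr z = z + φ z + φ (φ z) := by rw [hTr, hφ, hφ]; ring
    rw [hT, hu, inv_div]
    simp only [map_add, map_mul, map_div₀, h3]
    ring
  rw [hN, hN]
  constructor
  · intro h
    by_cases hdeg : φ (φ A) * φ (φ B) = A * B ∧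
        A * B * r = A * φ A * φ (φ A) + B * φ B * φ (φ B)
    · refine ⟨fun hr0 ↦ ?_, hdeg.2⟩
      have hAB1 : φ A * φ B = A * B := by
        have := congrArg φ hdeg.1
        simpa only [map_mul, h3, eq_comm] using this
      obtain ⟨x, hx, hxe⟩ := exists_ne_zero_of_dickson_det_eq_zero hq hq1 hF (φ A) (φ (φ B)) 0 (by
        simp only [← hφ, h3, map_zero]
        linear_combination A * B * hr0 - hdeg.2)
      rw [← hφ, zero_mul, add_zero] at hxe
      have hxe1 := congrArg φ hxe
      have hxe2 := congrArg (fun a ↦ φ (φ a)) hxe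
      simp only [map_add, map_mul, h3, map_zero] at hxe1 hxe2
      have hx1 : φ x ≠ 0 := (map_ne_zero φ).mpr hx
      have hx2 : φ (φ x) ≠ 0 := (map_ne_zero φ).mpr hx1
      apply h x hx
      rw [hval x hx, hr0]
      have hfac := mul_cubic_eq_prod_linear_sub hx hx1 hx2 hAB1 hdeg.1
      rw [← hdeg.2, hr0, hxe] at hfac
      rw [add_zero]
      refine (mul_eq_zero.mp ((mul_eq_zero.mp ?_).resolve_right
        (mul_ne_zero (mul_ne_zero hx hx1) hx2))).resolve_left (mul_ne_zero hA hB)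
      linear_combination hfac
    · exfalso
      obtain ⟨z, hz, hzN⟩ := exists_trace_eq_and_norm_eq hq hq1 hF (φ (φ (A * B))) r
        (-(A * φ A * φ (φ A) + B * φ B * φ (φ B))) hr
        (by rw [← hφ]; simp only [map_neg, map_add, map_mul, h3]; ring)
        (by
          rw [← hφ, h3, map_mul, map_mul]
          rintro ⟨h1, h2⟩
          exact hdeg ⟨h1.symm, by linear_combination r * h1 + h2⟩)
      simp only [← hφ, h3] at hz hzN
      simp only [map_mul] at hzN
      obtain ⟨y, hy, hye⟩ := exists_ne_zero_of_dickson_det_eq_zero hq hq1 hF A (-z) (φ B) (by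
        simp only [← hφ, h3, map_neg]
        linear_combination -hzN)
      rw [← hφ, ← hφ] at hye
      have hye1 := congrArg φ hye
      have hye2 := congrArg (fun a ↦ φ (φ a)) hye
      simp only [map_add, map_mul, map_neg, h3, map_zero] at hye1 hye2
      have hy1 : φ y ≠ 0 := (map_ne_zero φ).mpr hy
      have hy2 : φ (φ y) ≠ 0 := (map_ne_zero φ).mpr hy1
      have e0 : z = A * (y / φ y) + φ B * (φ (φ y) / φ y) := by
        field_simp
        linear_combination -hye
      have e1 : φ z = φ A * (φ y / φ (φ y)) + φ (φ B) * (y / φ (φ y)) := by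
        field_simp
        linear_combination -hye1
      have e2 : φ (φ z) = φ (φ A) * (φ (φ y) / y) + B * (φ y / y) := by
        field_simp
        linear_combination -hye2
      apply h y⁻¹ (inv_ne_zero hy)
      rw [hval _ (inv_ne_zero hy)]
      simp only [map_inv₀, inv_div_inv]
      linear_combination hz - e0 - e1 - e2
  · rintro ⟨hr0, hABr⟩ x hx hroot
    rw [hval x hx] at hroot
    have hx1 : φ x ≠ 0 := (map_ne_zero φ).mpr hx
    have hx2 : φ (φ x) ≠ 0 := (map_ne_zero φ).mpr hx1
    have hAB : φ A * φ B = A * B := by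
      have h := congrArg φ hABr
      simp only [map_add, map_mul, h3, hφr] at h
      apply mul_right_cancel₀ hr0
      linear_combination h - hABr
    have hAB2 : φ (φ A) * φ (φ B) = A * B := by
      rw [← map_mul, hAB, map_mul, hAB]
    have hfac := mul_cubic_eq_prod_linear_sub hx hx1 hx2 hAB hAB2
    rw [eq_neg_of_add_eq_zero_left hroot, ← hABr] at hfac
    have hprod : (φ (φ A) * φ x + B * φ (φ x)) * (A * φ (φ x) + φ B * x) *
        (φ A * x + φ (φ B) * φ x) = 0 := by
      linear_combination -hfac
    have hlin : φ A * x + φ (φ B) * φ x = 0 := by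
      rcases mul_eq_zero.mp hprod with h | h
      · rcases mul_eq_zero.mp h with h | h
        · simpa only [map_add, map_mul, h3, map_zero] using congrArg (fun a ↦ φ (φ a)) h
        · simpa only [map_add, map_mul, h3, map_zero] using congrArg φ h
      · exact h
    have hlin1 := congrArg φ hlin
    have hlin2 := congrArg (fun a ↦ φ (φ a)) hlin
    simp only [map_add, map_mul, h3, map_zero] at hlin1 hlin2
    refine mul_ne_zero (mul_ne_zero (mul_ne_zero hA hB) hr0)
      (mul_ne_zero (mul_ne_zero hx hx1) hx2) ?_
    linear_combination x * φ x * φ (φ x) * hABr + φ (φ A) * φ x * A * φ (φ x) * hlin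
      - φ (φ B) * φ x * A * φ (φ x) * hlin1 + φ (φ B) * φ x * B * φ (φ x) * hlin2
end
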